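/- For every ε > 0, the Talenti function u_ε(x) = C_{N,p} ε^{−(N−p)/p}[1 + (|x|/ε)^{p/(p−1)}]^{−(N−p)/p} (with any constant C_{N,p} > 0) attains the best Sobolev constant: ∫_{ℝ^N}|∇u_ε|^p dx / (∫_{ℝ^N} u_ε^{p*} dx)^{p/p*} = S. -/

import Mathlib

open MeasureTheory

/-- The best Sobolev constant
`S = inf { ∫|∇u|^p / (∫|u|^{p*})^{p/p*} : u ∈ C_c^∞(ℝ^N;ℝ), u ≠ 0 }`, `p* = Np/(N−p)`. -/
noncomputable def sobolevS (N : ℕ) (p : ℝ) : ℝ :=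
  sInf { r : ℝ | ∃ u : EuclideanSpace ℝ (Fin N) → ℝ, ContDiff ℝ (⊤ : ℕ∞) u ∧ HasCompactSupport u ∧
    u ≠ 0 ∧ r = (∫ x, ‖fderiv ℝ u x‖ ^ p) /
      (∫ x, |u x| ^ ((N : ℝ) * p / ((N : ℝ) - p))) ^ (p / ((N : ℝ) * p / ((N : ℝ) - p))) }

theorem volume_add_le_of_isCompact {K L C : Set ℝ} (hK : IsCompact K) (hL : IsCompact L)
    (hKn : K.Nonempty) (hLn : L.Nonempty) (h : ∀ a ∈ K, ∀ b ∈ L, a + b ∈ C) :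
    volume K + volume L ≤ volume C := by
  obtain ⟨M, hM, hMmax⟩ := hK.exists_isGreatest hKn
  obtain ⟨m, hm, hmin⟩ := hL.exists_isLeast hLn
  have h1 : volume ((fun x => x + -m) ⁻¹' K) = volume K := measure_preimage_add_right _ _ _
  have h2 : volume ((fun x => x + -M) ⁻¹' L) = volume L := measure_preimage_add_right _ _ _
  rw [← h1, ← h2, ← measure_union₀]
  · refine measure_mono ?_
    rintro x (hx | hx)
    · simpa using h _ hx m hm
    · simpa using h M hM _ hx
  · exact (hL.measurableSet.preimage (measurable_add_const _)).nullMeasurableSet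
  · refine measure_mono_null (t := {M + m}) ?_ (by simp)
    rintro x ⟨hx, hy⟩
    have e1 := hMmax hx
    have e2 := hmin hy
    simp only [Set.mem_singleton_iff]
    linarith

/-- The one-dimensional Brunn–Minkowski inequality. -/
theorem volume_add_le_of_add_mem {A B C : Set ℝ} (hA : MeasurableSet A) (hB : MeasurableSet B)
    (hAn : A.Nonempty) (hBn : B.Nonempty) (h : ∀ a ∈ A, ∀ b ∈ B, a + b ∈ C) :
    volume A + volume B ≤ volume C := by
  rw [hA.measure_eq_iSup_isCompact, hB.measure_eq_iSup_isCompact]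
  simp only [iSup_and']
  obtain ⟨a, ha⟩ := hAn
  obtain ⟨b, hb⟩ := hBn
  refine ENNReal.biSup_add_biSup_le' ⟨∅, by simp⟩ ⟨∅, by simp⟩ ?_
  rintro K ⟨hKA, hK⟩ L ⟨hLB, hL⟩
  refine le_trans (add_le_add (measure_mono (Set.subset_insert a K))
    (measure_mono (Set.subset_insert b L))) ?_
  refine volume_add_le_of_isCompact (hK.insert a) (hL.insert b) (by simp) (by simp) ?_
  intro x hx y hy
  exact h _ (Set.insert_subset ha hKA hx) _ (Set.insert_subset hb hLB hy)

theorem lintegral_eq_lintegral_meas_ofReal_lt {u : ℝ → ENNReal} (hu : Measurable u)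
    (h1 : ∀ x, u x ≤ 1) :
    ∫⁻ x, u x = ∫⁻ t in Set.Ioi (0 : ℝ), volume {x | ENNReal.ofReal t < u x} := by
  have key := lintegral_eq_lintegral_meas_lt (volume : Measure ℝ) (f := fun x => (u x).toReal)
    (Filter.Eventually.of_forall fun x => ENNReal.toReal_nonneg) hu.ennreal_toReal.aemeasurable
  have hfin : ∀ x, u x ≠ ⊤ := fun x => ne_top_of_le_ne_top ENNReal.one_ne_top (h1 x)
  simp only [ENNReal.ofReal_toReal (hfin _)] at key
  rw [key]
  refine setLIntegral_congr_fun measurableSet_Ioi fun t ht => ?_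
  simp only [ENNReal.ofReal_lt_iff_lt_toReal (le_of_lt ht) (hfin _)]

theorem lintegral_add_le_of_min_le {u v w : ℝ → ENNReal} (hu : Measurable u) (hv : Measurable v)
    (hw : Measurable w) (h : ∀ x y, min (u x) (v y) ≤ w (x + y))
    (hu1 : ∀ x, u x ≤ 1) (hv1 : ∀ x, v x ≤ 1)
    (hu2 : ∀ c < 1, ∃ x, c < u x) (hv2 : ∀ c < 1, ∃ x, c < v x) :
    (∫⁻ x, u x) + (∫⁻ x, v x) ≤ ∫⁻ x, w x := by
  have hw' : ∫⁻ x, min (w x) 1 ≤ ∫⁻ x, w x := lintegral_mono fun x => min_le_left _ _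
  refine le_trans ?_ hw'
  rw [lintegral_eq_lintegral_meas_ofReal_lt hu hu1, lintegral_eq_lintegral_meas_ofReal_lt hv hv1,
    lintegral_eq_lintegral_meas_ofReal_lt (hw.min measurable_const) fun x => min_le_right _ _,
    ← lintegral_add_left]
  · refine lintegral_mono fun t => ?_
    dsimp only
    rcases lt_or_ge (ENNReal.ofReal t) 1 with ht | ht
    · refine volume_add_le_of_add_mem (measurableSet_lt measurable_const hu)
        (measurableSet_lt measurable_const hv) (hu2 _ ht) (hv2 _ ht) fun a ha b hb => ?_
      exact lt_min (lt_of_lt_of_le (lt_min ha hb) (h a b)) ht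
    · have e1 : {x | ENNReal.ofReal t < u x} = ∅ := by
        ext x; simpa using (hu1 x).trans ht
      have e2 : {x | ENNReal.ofReal t < v x} = ∅ := by
        ext x; simpa using (hv1 x).trans ht
      simp [e1, e2]
  · have : Antitone fun t : ℝ => volume {x | ENNReal.ofReal t < u x} := fun s t hst =>
      measure_mono fun x hx => lt_of_le_of_lt (ENNReal.ofReal_le_ofReal hst) hx
    exact this.measurable

theorem lintegral_weighted_add_le {m : ℝ} (hm : 0 < m) {g W Q : ℝ → ENNReal}
    (hg : Measurable g) (hW : Measurable W)
    (hQ : Measurable Q) (h : ∀ x y, Q (x + y) ≤ g x + W y) {α β : ENNReal}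
    (hα : α = ⨅ x, g x) (hβ : β = ⨅ x, W x) (hα0 : α ≠ 0) (hβ0 : β ≠ 0) (hα1 : α ≠ ⊤)
    (hβ1 : β ≠ ⊤) :
    α ^ m * (∫⁻ x, g x ^ (-m)) + β ^ m * (∫⁻ x, W x ^ (-m)) ≤
      (α + β) ^ m * ∫⁻ x, Q x ^ (-m) := by
  have hγ0 : α + β ≠ 0 := by simp [hα0]
  have hγ1 : α + β ≠ ⊤ := by simp [hα1, hβ1]
  have key : ∀ {a : ENNReal}, a ≠ 0 → a ≠ ⊤ → ∀ {f : ℝ → ENNReal}, Measurable f →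
      a ^ m * ∫⁻ x, f x ^ (-m) = ∫⁻ x, (f x / a) ^ (-m) := by
    intro a ha0 ha1 f hf
    rw [← lintegral_const_mul _ (hf.pow_const _)]
    congr with x
    rw [ENNReal.rpow_neg, ENNReal.rpow_neg, ENNReal.div_rpow_of_nonneg _ _ hm.le, ENNReal.inv_div,
      div_eq_mul_inv]
    · exact Or.inl (ENNReal.rpow_ne_top_of_nonneg hm.le ha1)
    · exact Or.inl (by simp [ha0, hm.not_gt])
  have bound : ∀ {a : ENNReal}, a ≠ 0 → a ≠ ⊤ → ∀ {f : ℝ → ENNReal}, a = ⨅ x, f x →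
      (∀ x, (f x / a) ^ (-m) ≤ 1) ∧ ∀ c < 1, ∃ x, c < (f x / a) ^ (-m) := by
    intro a ha0 ha1 f haf
    constructor
    · intro x
      rw [ENNReal.rpow_neg, ENNReal.inv_le_one]
      have : 1 ≤ f x / a := by
        rw [ENNReal.le_div_iff_mul_le (Or.inl ha0) (Or.inl ha1), one_mul, haf]
        exact iInf_le _ _
      exact ENNReal.one_le_rpow this hm
    · intro c hc
      have hr : a < (c⁻¹) ^ m⁻¹ * a := by
        have h1 : 1 < (c⁻¹) ^ m⁻¹ := ENNReal.one_lt_rpow (ENNReal.one_lt_inv.2 hc) (inv_pos.2 hm)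
        calc a = 1 * a := (one_mul a).symm
          _ < _ := ENNReal.mul_lt_mul_left ha0 ha1 h1
      conv at hr => lhs; rw [haf]
      obtain ⟨x, hx⟩ := iInf_lt_iff.1 hr
      refine ⟨x, ?_⟩
      rw [ENNReal.rpow_neg, ← ENNReal.inv_lt_inv, inv_inv, ← ENNReal.lt_rpow_inv_iff hm]
      rwa [ENNReal.div_lt_iff (Or.inl ha0) (Or.inl ha1)]
  rw [key hα0 hα1 hg, key hβ0 hβ1 hW, key hγ0 hγ1 hQ]
  refine lintegral_add_le_of_min_le ((hg.div_const _).pow_const _) ((hW.div_const _).pow_const _)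
    ((hQ.div_const _).pow_const _) ?_ (bound hα0 hα1 hα).1 (bound hβ0 hβ1 hβ).1
    (bound hα0 hα1 hα).2 (bound hβ0 hβ1 hβ).2
  intro x y
  have anti : Antitone fun r : ENNReal => r ^ (-m) := by
    intro r s hrs
    simp only [ENNReal.rpow_neg]
    exact ENNReal.inv_le_inv.2 (ENNReal.rpow_le_rpow hrs hm.le)
  rw [← anti.map_max]
  refine anti ?_
  rw [ENNReal.div_le_iff hγ0 hγ1]
  refine (h x y).trans ?_
  rw [mul_add]
  refine add_le_add ?_ ?_
  · rw [← ENNReal.div_le_iff hα0 hα1]; exact le_max_left _ _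
  · rw [← ENNReal.div_le_iff hβ0 hβ1]; exact le_max_right _ _

theorem lintegral_rpow_neg_truncated {m : ℝ} (hm : 0 < m) {g W Q : ℝ → ENNReal}
    (hg : Measurable g) (hW : Measurable W)
    (hQ : Measurable Q) (h : ∀ x y, Q (x + y) ≤ g x + W y) {ε : ENNReal} (hε : ε ≠ 0)
    (hgε : ∀ x, ε ≤ g x) (hWε : ∀ x, ε ≤ W x)
    (hA : ∫⁻ x, g x ^ (-m) ≠ 0) (hB : ∫⁻ x, W x ^ (-m) ≠ 0) :
    ∃ α β : ENNReal, α ≠ 0 ∧ α ≠ ⊤ ∧ β ≠ 0 ∧ β ≠ ⊤ ∧ 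
    α ^ m * (∫⁻ x, g x ^ (-m)) + β ^ m * (∫⁻ x, W x ^ (-m)) ≤
      (α + β) ^ m * ∫⁻ x, Q x ^ (-m) := by
  have key : ∀ f : ℝ → ENNReal, (∀ x, ε ≤ f x) → ∫⁻ x, f x ^ (-m) ≠ 0 →
      (⨅ x, f x) ≠ 0 ∧ (⨅ x, f x) ≠ ⊤ := by
    intro f hf hf0
    constructor
    · exact (lt_of_lt_of_le (pos_iff_ne_zero.2 hε) (le_iInf hf)).ne'
    · intro htop
      apply hf0
      have : ∀ x, f x = ⊤ := iInf_eq_top.1 htop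
      simp [this, ENNReal.top_rpow_of_neg (neg_lt_zero.2 hm)]
  exact ⟨⨅ x, g x, ⨅ x, W x, (key g hgε hA).1, (key g hgε hA).2, (key W hWε hB).1,
    (key W hWε hB).2, lintegral_weighted_add_le hm hg hW hQ h rfl rfl (key g hgε hA).1
    (key W hWε hB).1 (key g hgε hA).2 (key W hWε hB).2⟩

theorem add_rpow_mul_add_rpow_le {m : ℝ} (hm : 1 ≤ m) {a b α β : NNReal} (ha : a ≠ 0) (hb : b ≠ 0) :
    (α + β) ^ m * (a + b) ^ (-(m - 1)) ≤ α ^ m * a ^ (-(m - 1)) + β ^ m * b ^ (-(m - 1)) := by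
  have hab : a + b ≠ 0 := by simp [ha]
  have key := NNReal.rpow_arith_mean_le_arith_mean2_rpow (a / (a + b)) (b / (a + b)) (α / a) (β / b)
    (by rw [← add_div, div_self hab]) hm
  have e1 : a / (a + b) * (α / a) + b / (a + b) * (β / b) = (α + β) / (a + b) := by
    field_simp
  have e2 : ∀ c : NNReal, c ≠ 0 → c ^ (-(m - 1)) = c / c ^ m := by
    intro c hc
    rw [show -(m - 1) = 1 - m by ring, NNReal.rpow_sub hc, NNReal.rpow_one]
  rw [e1, NNReal.div_rpow, NNReal.div_rpow, NNReal.div_rpow] at key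
  rw [e2 a ha, e2 b hb, e2 _ hab]
  calc (α + β) ^ m * ((a + b) / (a + b) ^ m) = (a + b) * ((α + β) ^ m / (a + b) ^ m) := by ring
    _ ≤ (a + b) * (a / (a + b) * (α ^ m / a ^ m) + b / (a + b) * (β ^ m / b ^ m)) := by gcongr
    _ = _ := by field_simp

theorem rpow_neg_le_of_weighted {m : ℝ} (hm : 1 < m) {A B C α β : ENNReal} (hα0 : α ≠ 0)
    (hα1 : α ≠ ⊤) (hβ0 : β ≠ 0) (hβ1 : β ≠ ⊤)
    (h : α ^ m * A + β ^ m * B ≤ (α + β) ^ m * C) :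
    C ^ (-(1 / (m - 1))) ≤ A ^ (-(1 / (m - 1))) + B ^ (-(1 / (m - 1))) := by
  have hm1 : 0 < m - 1 := by linarith
  have hm0 : 0 < m := by linarith
  have inv : ∀ X : ENNReal, X = (X ^ (-(1 / (m - 1)))) ^ (-(m - 1)) := by
    intro X
    rw [← ENNReal.rpow_mul, show -(1 / (m - 1)) * -(m - 1) = 1 by field_simp, ENNReal.rpow_one]
  generalize ha : A ^ (-(1 / (m - 1))) = a
  generalize hb : B ^ (-(1 / (m - 1))) = b
  have hA := inv A
  have hB := inv B
  rw [ha] at hA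
  rw [hb] at hB
  suffices hC : (a + b) ^ (-(m - 1)) ≤ C by
    have e : (a + b) = ((a + b) ^ (-(m - 1))) ^ (-(1 / (m - 1))) := by
      rw [← ENNReal.rpow_mul, show -(m - 1) * -(1 / (m - 1)) = 1 by field_simp, ENNReal.rpow_one]
    rw [e, ENNReal.rpow_neg, ENNReal.rpow_neg _ (1 / (m - 1)), ENNReal.inv_le_inv]
    exact ENNReal.rpow_le_rpow hC (by positivity)
  have hγ0 : α + β ≠ 0 := by simp [hα0]
  have hγ1 : α + β ≠ ⊤ := by simp [hα1, hβ1]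
  have hγm : (α + β) ^ m ≠ ⊤ := ENNReal.rpow_ne_top_of_nonneg hm0.le hγ1
  have pos : ∀ {x : ENNReal}, x ≠ 0 → x ^ m ≠ 0 := fun hx => by simp [hx, hm0.not_gt]
  by_cases hC : C = ⊤
  · simp [hC]
  have hlt : α ^ m * A + β ^ m * B < ⊤ := lt_of_le_of_lt h (ENNReal.mul_lt_top hγm.lt_top
    (Ne.lt_top hC))
  by_cases ha0 : a = 0
  · rw [hA, ha0, ENNReal.zero_rpow_of_neg (by linarith), ENNReal.mul_top (pos hα0)] at hlt
    simp at hlt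
  by_cases hb0 : b = 0
  · rw [hB, hb0, ENNReal.zero_rpow_of_neg (by linarith), ENNReal.mul_top (pos hβ0)] at hlt
    simp at hlt
  by_cases ha1 : a = ⊤
  · simp [ha1, hm]
  by_cases hb1 : b = ⊤
  · simp [hb1, hm]
  rw [hA, hB] at h
  clear hA hB ha hb hlt hC inv
  rw [← ENNReal.mul_le_mul_iff_right (pos hγ0) hγm]
  refine le_trans ?_ h
  lift a to NNReal using ha1
  lift b to NNReal using hb1
  lift α to NNReal using hα1
  lift β to NNReal using hβ1
  have ha0 : a ≠ 0 := by exact_mod_cast ha0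
  have hb0 : b ≠ 0 := by exact_mod_cast hb0
  rw [← ENNReal.coe_add, ← ENNReal.coe_add, ← ENNReal.coe_rpow_of_ne_zero ha0,
    ← ENNReal.coe_rpow_of_ne_zero hb0,
    ← ENNReal.coe_rpow_of_ne_zero (show a + b ≠ 0 by simp [ha0]),
    ← ENNReal.coe_rpow_of_nonneg _ hm0.le, ← ENNReal.coe_rpow_of_nonneg _ hm0.le,
    ← ENNReal.coe_rpow_of_nonneg _ hm0.le]
  exact_mod_cast add_rpow_mul_add_rpow_le hm.le ha0 hb0

theorem tendsto_lintegral_max_inv_rpow_neg {m : ℝ} (hm : 0 < m) {g : ℝ → ENNReal}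
    (hg : Measurable g) :
    Filter.Tendsto (fun k : ℕ => ∫⁻ x, max (g x) (k : ENNReal)⁻¹ ^ (-m)) Filter.atTop
      (nhds (∫⁻ x, g x ^ (-m))) := by
  refine lintegral_tendsto_of_tendsto_of_monotone
    (fun k => ((hg.max measurable_const).pow_const _).aemeasurable)
    (Filter.Eventually.of_forall fun x => ?_) (Filter.Eventually.of_forall fun x => ?_)
  · intro i j hij
    simp only [ENNReal.rpow_neg]
    refine ENNReal.inv_le_inv.2 (ENNReal.rpow_le_rpow ?_ hm.le)
    exact max_le_max le_rfl (ENNReal.inv_le_inv.2 (by exact_mod_cast hij))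
  · have h1 : Filter.Tendsto (fun k : ℕ => max (g x) (k : ENNReal)⁻¹) Filter.atTop
        (nhds (max (g x) 0)) :=
      tendsto_const_nhds.max ENNReal.tendsto_inv_nat_nhds_zero
    rw [max_eq_left (zero_le)] at h1
    exact (ENNReal.continuous_rpow_const.tendsto (g x)).comp h1

theorem weighted_max_inv {m : ℝ} (hm : 0 < m) {g W Q : ℝ → ENNReal}
    (hg : Measurable g) (hW : Measurable W)
    (hQ : Measurable Q) (h : ∀ x y, Q (x + y) ≤ g x + W y) (k : ℕ)
    (hA : ∫⁻ x, max (g x) (k : ENNReal)⁻¹ ^ (-m) ≠ 0)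
    (hB : ∫⁻ x, max (W x) (k : ENNReal)⁻¹ ^ (-m) ≠ 0) :
    ∃ α β : ENNReal, α ≠ 0 ∧ α ≠ ⊤ ∧ β ≠ 0 ∧ β ≠ ⊤ ∧
    α ^ m * (∫⁻ x, max (g x) (k : ENNReal)⁻¹ ^ (-m)) +
      β ^ m * (∫⁻ x, max (W x) (k : ENNReal)⁻¹ ^ (-m)) ≤ (α + β) ^ m * ∫⁻ x, Q x ^ (-m) :=
  lintegral_rpow_neg_truncated hm (hg.max measurable_const) (hW.max measurable_const) hQ
    (fun x y => (h x y).trans (add_le_add (le_max_left _ _) (le_max_left _ _)))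
    (ε := (k : ENNReal)⁻¹) (by simp) (fun x => le_max_right _ _) (fun x => le_max_right _ _) hA hB

theorem lintegral_rpow_neg_one_dim {m : ℝ} (hm : 1 < m) {g W Q : ℝ → ENNReal}
    (hg : Measurable g) (hW : Measurable W)
    (hQ : Measurable Q) (h : ∀ x y, Q (x + y) ≤ g x + W y) :
    (∫⁻ x, Q x ^ (-m)) ^ (-(1 / (m - 1))) ≤
      (∫⁻ x, g x ^ (-m)) ^ (-(1 / (m - 1))) + (∫⁻ x, W x ^ (-m)) ^ (-(1 / (m - 1))) := by
  have hm1 : 0 < m - 1 := by linarith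
  have hs : -(1 / (m - 1)) < 0 := by rw [neg_lt_zero]; positivity
  have ht := fun {f : ℝ → ENNReal} (hf : Measurable f) =>
    (ENNReal.continuous_rpow_const (y := -(1 / (m - 1)))).continuousAt.tendsto.comp
      (tendsto_lintegral_max_inv_rpow_neg (show 0 < m by linarith) hf)
  refine ge_of_tendsto' ((ht hg).add (ht hW)) fun k => ?_
  dsimp only [Function.comp]
  by_cases hA : ∫⁻ x, max (g x) (k : ENNReal)⁻¹ ^ (-m) = 0
  · rw [hA, ENNReal.zero_rpow_of_neg hs]; simp
  by_cases hB : ∫⁻ x, max (W x) (k : ENNReal)⁻¹ ^ (-m) = 0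
  · rw [hB, ENNReal.zero_rpow_of_neg hs]; simp
  obtain ⟨α, β, h1, h2, h3, h4, h5⟩ := weighted_max_inv (by linarith) hg hW hQ h k hA hB
  exact rpow_neg_le_of_weighted hm h1 h2 h3 h4 h5

theorem min_le_lintegral_rpow_neg_one {g W Q : ℝ → ENNReal}
    (hg : Measurable g) (hW : Measurable W)
    (hQ : Measurable Q) (h : ∀ x y, Q (x + y) ≤ g x + W y) :
    min (∫⁻ x, g x ^ (-1 : ℝ)) (∫⁻ x, W x ^ (-1 : ℝ)) ≤ ∫⁻ x, Q x ^ (-1 : ℝ) := by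
  refine le_of_tendsto' ((tendsto_lintegral_max_inv_rpow_neg one_pos hg).min
    (tendsto_lintegral_max_inv_rpow_neg one_pos hW)) fun k => ?_
  by_cases hA : ∫⁻ x, max (g x) (k : ENNReal)⁻¹ ^ (-1 : ℝ) = 0
  · simp [hA]
  by_cases hB : ∫⁻ x, max (W x) (k : ENNReal)⁻¹ ^ (-1 : ℝ) = 0
  · simp [hB]
  obtain ⟨α, β, h1, h2, h3, h4, h5⟩ := weighted_max_inv one_pos hg hW hQ h k hA hB
  simp only [ENNReal.rpow_one] at h5
  have hγ0 : α + β ≠ 0 := by simp [h1]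
  have hγ1 : α + β ≠ ⊤ := by simp [h2, h4]
  rw [← ENNReal.mul_le_mul_iff_right hγ0 hγ1]
  refine le_trans ?_ h5
  rw [add_mul]
  exact add_le_add (mul_le_mul_right (min_le_left _ _) _) (mul_le_mul_right (min_le_right _ _) _)

theorem lintegral_fin_succ {n : ℕ} {f : (Fin (n + 1) → ℝ) → ENNReal} (hf : Measurable f) :
    ∫⁻ x, f x = ∫⁻ y : Fin n → ℝ, ∫⁻ t : ℝ, f (Fin.cons t y) := by
  have hmp := (volume_preserving_piFinSuccAbove (fun _ : Fin (n + 1) => ℝ) 0).symm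
  have e : ∀ q : ℝ × (Fin n → ℝ),
      (MeasurableEquiv.piFinSuccAbove (fun _ : Fin (n + 1) => ℝ) 0).symm q = Fin.cons q.1 q.2 := by
    intro q
    simp [MeasurableEquiv.piFinSuccAbove, Fin.insertNthEquiv]
  rw [← hmp.lintegral_comp_emb (MeasurableEquiv.measurableEmbedding _), Measure.volume_eq_prod,
    lintegral_prod_symm]
  · simp only [e]
  · exact (hf.comp (MeasurableEquiv.measurable _)).aemeasurable

theorem measurable_fin_cons {n : ℕ} :
    Measurable fun q : ℝ × (Fin n → ℝ) => (Fin.cons q.1 q.2 : Fin (n + 1) → ℝ) := by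
  refine measurable_pi_lambda _ fun i => ?_
  refine Fin.cases ?_ (fun j => ?_) i
  · simpa using measurable_fst
  · simpa using! (measurable_pi_apply j).comp measurable_snd

theorem fin_cons_add {n : ℕ} (s t : ℝ) (x y : Fin n → ℝ) :
    (Fin.cons (s + t) (x + y) : Fin (n + 1) → ℝ) = Fin.cons s x + Fin.cons t y := by
  ext i
  refine Fin.cases ?_ (fun j => ?_) i <;> simp

/-- A Borell–Brascamp–Lieb inequality in homogeneous form. -/
theorem min_lintegral_rpow_neg_le (n : ℕ) : ∀ {g W Q : (Fin (n + 1) → ℝ) → ENNReal},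
    Measurable g → Measurable W → Measurable Q → (∀ x y, Q (x + y) ≤ g x + W y) →
    min (∫⁻ x, g x ^ (-((n + 1 : ℕ) : ℝ))) (∫⁻ x, W x ^ (-((n + 1 : ℕ) : ℝ))) ≤
      ∫⁻ x, Q x ^ (-((n + 1 : ℕ) : ℝ)) := by
  induction n with
  | zero =>
    intro g W Q hg hW hQ h
    rw [lintegral_fin_succ (hg.pow_const _), lintegral_fin_succ (hW.pow_const _),
      lintegral_fin_succ (hQ.pow_const _)]
    simp only [zero_add, Nat.cast_one, lintegral_unique, Measure.volume_pi_eq_dirac default,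
      Measure.dirac_apply_of_mem (Set.mem_univ _), mul_one]
    have c : ∀ z : Fin 0 → ℝ, Measurable fun t : ℝ => (Fin.cons t z : Fin 1 → ℝ) :=
      fun z => measurable_fin_cons.comp (measurable_id.prodMk measurable_const)
    refine min_le_lintegral_rpow_neg_one (hg.comp (c _)) (hW.comp (c _)) (hQ.comp (c _))
      fun x y => ?_
    have := h (Fin.cons x default) (Fin.cons y default)
    rw [← fin_cons_add] at this
    convert this using 3 <;> exact congrArg _ (Subsingleton.elim _ _)
  | succ n ih =>
    intro g W Q hg hW hQ h
    have hm : (1 : ℝ) < ((n + 1 + 1 : ℕ) : ℝ) := by push_cast; linarith [n.cast_nonneg (α := ℝ)]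
    have key : ∀ {f : (Fin (n + 1 + 1) → ℝ) → ENNReal}, Measurable f →
        (∫⁻ x, f x ^ (-((n + 1 + 1 : ℕ) : ℝ))) = ∫⁻ y : Fin (n + 1) → ℝ,
          ((∫⁻ t : ℝ, f (Fin.cons t y) ^ (-((n + 1 + 1 : ℕ) : ℝ))) ^
            (-(1 / (((n + 1 + 1 : ℕ) : ℝ) - 1)))) ^ (-((n + 1 : ℕ) : ℝ)) := by
      intro f hf
      rw [lintegral_fin_succ (hf.pow_const _)]
      refine lintegral_congr fun y => ?_
      rw [← ENNReal.rpow_mul]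
      have : -(1 / (((n + 1 + 1 : ℕ) : ℝ) - 1)) * -((n + 1 : ℕ) : ℝ) = 1 := by
        push_cast
        have : (n : ℝ) + 1 ≠ 0 := by positivity
        field_simp
        ring
      rw [this, ENNReal.rpow_one]
    have meas : ∀ {f : (Fin (n + 1 + 1) → ℝ) → ENNReal}, Measurable f →
        Measurable fun y : Fin (n + 1) → ℝ =>
          (∫⁻ t : ℝ, f (Fin.cons t y) ^ (-((n + 1 + 1 : ℕ) : ℝ))) ^
            (-(1 / (((n + 1 + 1 : ℕ) : ℝ) - 1))) := by
      intro f hf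
      refine Measurable.pow_const ?_ _
      exact ((hf.comp measurable_fin_cons).pow_const _).lintegral_prod_left'
    rw [key hg, key hW, key hQ]
    refine ih (meas hg) (meas hW) (meas hQ) fun x y => ?_
    have c : ∀ z : Fin (n + 1) → ℝ, Measurable fun t : ℝ => (Fin.cons t z : Fin (n + 1 + 1) → ℝ) :=
      fun z => measurable_fin_cons.comp (measurable_id.prodMk measurable_const)
    refine lintegral_rpow_neg_one_dim hm (hg.comp (c x)) (hW.comp (c y)) (hQ.comp (c (x + y)))
      fun s t => ?_
    have := h (Fin.cons s x) (Fin.cons t y)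
    rwa [← fin_cons_add] at this

theorem min_lintegral_rpow_neg_le_euclidean {n : ℕ} (hn : 0 < n)
    {g W Q : EuclideanSpace ℝ (Fin n) → ENNReal}
    (hg : Measurable g) (hW : Measurable W) (hQ : Measurable Q)
    (h : ∀ x y, Q (x + y) ≤ g x + W y) :
    min (∫⁻ x, g x ^ (-(n : ℝ))) (∫⁻ x, W x ^ (-(n : ℝ))) ≤ ∫⁻ x, Q x ^ (-(n : ℝ)) := by
  obtain ⟨k, rfl⟩ : ∃ k, n = k + 1 := ⟨n - 1, by omega⟩
  have hmp := PiLp.volume_preserving_toLp (Fin (k + 1))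
  have key := fun f => hmp.lintegral_comp_emb (MeasurableEquiv.toLp 2 _).measurableEmbedding f
  rw [← key, ← key, ← key]
  have m : Measurable (WithLp.toLp 2 : (Fin (k + 1) → ℝ) → EuclideanSpace ℝ (Fin (k + 1))) :=
    hmp.measurable
  exact min_lintegral_rpow_neg_le k (hg.comp m) (hW.comp m) (hQ.comp m) fun x y => by
    simpa using h (WithLp.toLp 2 x) (WithLp.toLp 2 y)

theorem lintegral_Ioi_add_rpow_neg {a s : ℝ} (ha : 0 < a) (hs : 1 < s) :
    ∫⁻ t in Set.Ioi (0 : ℝ), ENNReal.ofReal ((a + t) ^ (-s)) =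
      ENNReal.ofReal (a ^ (1 - s)) / ENNReal.ofReal (s - 1) := by
  have e : ∫⁻ t in Set.Ioi (0 : ℝ), ENNReal.ofReal ((a + t) ^ (-s)) =
      ∫⁻ t in Set.Ioi a, ENNReal.ofReal (t ^ (-s)) := by
    have hmp := measurePreserving_add_left (volume : Measure ℝ) a
    have := hmp.setLIntegral_comp_emb (measurableEmbedding_addLeft a)
      (fun t => ENNReal.ofReal (t ^ (-s))) (Set.Ioi 0)
    rw [this]
    simp
  rw [e, ← ofReal_integral_eq_lintegral_ofReal, integral_Ioi_rpow_of_lt (by linarith) ha,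
    ← ENNReal.ofReal_div_of_pos (by linarith)]
  · congr 1
    rw [show -s + 1 = 1 - s by ring, ← neg_div_neg_eq, neg_neg, neg_sub]
  · exact integrableOn_Ioi_rpow_of_lt (by linarith) ha
  · refine (ae_restrict_iff' measurableSet_Ioi).2 (Filter.Eventually.of_forall fun t ht => ?_)
    exact Real.rpow_nonneg (by have : a < t := ht; linarith) _

theorem measurable_add_rpow_neg {E : Type*} [MeasurableSpace E] {f : E → ℝ} (hf : Measurable f)
    (s : ℝ) : Measurable fun q : ℝ × E => ENNReal.ofReal ((f q.2 + q.1) ^ (-s)) :=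
  (((hf.comp measurable_snd).add measurable_fst).pow_const _).ennreal_ofReal

theorem lintegral_Ioi_lintegral_add_rpow_neg {E : Type*} [MeasureSpace E]
    [SFinite (volume : Measure E)] {f : E → ℝ} (hf : Measurable f) (hf0 : ∀ x, 0 < f x) {s : ℝ}
    (hs : 1 < s) :
    ∫⁻ t in Set.Ioi (0 : ℝ), ∫⁻ x, ENNReal.ofReal ((f x + t) ^ (-s)) =
      (∫⁻ x, ENNReal.ofReal (f x ^ (1 - s))) / ENNReal.ofReal (s - 1) := by
  rw [lintegral_lintegral_swap (measurable_add_rpow_neg hf s).aemeasurable]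
  simp only [lintegral_Ioi_add_rpow_neg (hf0 _) hs]
  simp only [div_eq_mul_inv]
  rw [lintegral_mul_const _ (hf.pow_const _).ennreal_ofReal]

/-- A dimension-improved Borell–Brascamp–Lieb inequality in homogeneous form. -/
theorem lintegral_rpow_one_sub_add_le {n : ℕ} (hn : 2 ≤ n) {g W Q : EuclideanSpace ℝ (Fin n) → ℝ}
    (hg : Measurable g) (hW : Measurable W) (hQ : Measurable Q)
    (hg0 : ∀ x, 0 < g x) (hW0 : ∀ x, 0 < W x) (hQ0 : ∀ x, 0 < Q x)
    (h : ∀ x y, Q (x + y) ≤ g x + W y)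
    (heq : ∫⁻ x, ENNReal.ofReal (g x ^ (-(n : ℝ))) = ∫⁻ x, ENNReal.ofReal (W x ^ (-(n : ℝ))))
    (hfin : ∫⁻ x, ENNReal.ofReal (g x ^ (-(n : ℝ))) ≠ ⊤) :
    (∫⁻ x, ENNReal.ofReal (g x ^ (1 - (n : ℝ)))) + (∫⁻ x, ENNReal.ofReal (W x ^ (1 - (n : ℝ)))) ≤
      ∫⁻ x, ENNReal.ofReal (Q x ^ (1 - (n : ℝ))) := by
  have hn1 : (1 : ℝ) < n := by exact_mod_cast hn
  set A := ∫⁻ x, ENNReal.ofReal (g x ^ (-(n : ℝ))) with hA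
  have hA0 : A ≠ 0 := by
    intro h0
    rw [hA, lintegral_eq_zero_iff (hg.pow_const _).ennreal_ofReal] at h0
    obtain ⟨x, hx⟩ := h0.exists
    have := Real.rpow_pos_of_pos (hg0 x) (-(n : ℝ))
    simp only [Pi.zero_apply, ENNReal.ofReal_eq_zero] at hx
    linarith
  let Φ : (EuclideanSpace ℝ (Fin n) → ℝ) → ℝ → ENNReal := fun f t =>
    ∫⁻ x, ENNReal.ofReal ((f x + t) ^ (-(n : ℝ)))
  let u : (EuclideanSpace ℝ (Fin n) → ℝ) → ℝ → ENNReal := fun f =>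
    (Set.Ioi (0 : ℝ)).indicator fun t => Φ f t / A
  have hΦm : ∀ {f : EuclideanSpace ℝ (Fin n) → ℝ}, Measurable f → Measurable (Φ f) := fun hf =>
    (measurable_add_rpow_neg hf _).lintegral_prod_right'
  have hum : ∀ {f : EuclideanSpace ℝ (Fin n) → ℝ}, Measurable f → Measurable (u f) := fun hf =>
    ((hΦm hf).div_const _).indicator measurableSet_Ioi
  have hu_int : ∀ {f : EuclideanSpace ℝ (Fin n) → ℝ}, Measurable f → (∀ x, 0 < f x) →
      ∫⁻ t, u f t =
        (∫⁻ x, ENNReal.ofReal (f x ^ (1 - (n : ℝ)))) / ENNReal.ofReal ((n : ℝ) - 1) / A := by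
    intro f hf hf0
    rw [lintegral_indicator measurableSet_Ioi]
    simp only [div_eq_mul_inv _ A]
    rw [lintegral_mul_const _ (hΦm hf), lintegral_Ioi_lintegral_add_rpow_neg hf hf0 hn1]
  have hu_le : ∀ {f : EuclideanSpace ℝ (Fin n) → ℝ}, (∀ x, 0 < f x) →
      ∫⁻ x, ENNReal.ofReal (f x ^ (-(n : ℝ))) = A → ∀ t, u f t ≤ 1 := by
    intro f hf0 hfA t
    by_cases ht : 0 < t
    · simp only [u, Set.indicator_of_mem (Set.mem_Ioi.2 ht)]
      refine ENNReal.div_le_of_le_mul ?_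
      rw [one_mul, ← hfA]
      refine lintegral_mono fun x => ENNReal.ofReal_le_ofReal ?_
      exact Real.rpow_le_rpow_of_nonpos (hf0 x) (by linarith) (by linarith)
    · simp [u, Set.indicator_of_notMem (Set.notMem_Ioi.2 (not_lt.1 ht))]
  have hu_sup : ∀ {f : EuclideanSpace ℝ (Fin n) → ℝ}, Measurable f → (∀ x, 0 < f x) →
      ∫⁻ x, ENNReal.ofReal (f x ^ (-(n : ℝ))) = A → ∀ c < 1, ∃ t, c < u f t := by
    intro f hf hf0 hfA c hc
    have hlim : Filter.Tendsto (fun k : ℕ => Φ f (1 / ((k : ℝ) + 1))) Filter.atTop (nhds A) := by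
      rw [← hfA]
      refine lintegral_tendsto_of_tendsto_of_monotone
        (fun k => ((hf.add_const _).pow_const _).ennreal_ofReal.aemeasurable)
        (Filter.Eventually.of_forall fun x => ?_) (Filter.Eventually.of_forall fun x => ?_)
      · intro i j hij
        refine ENNReal.ofReal_le_ofReal
          (Real.rpow_le_rpow_of_nonpos ?_ ?_ (by linarith))
        · have := hf0 x; positivity
        · have := one_div_le_one_div_of_le (show (0 : ℝ) < (i : ℝ) + 1 by positivity)
            (show (i : ℝ) + 1 ≤ (j : ℝ) + 1 by exact_mod_cast Nat.succ_le_succ hij)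
          linarith
      · refine (ENNReal.continuous_ofReal.tendsto _).comp ?_
        have h1 : Filter.Tendsto (fun k : ℕ => f x + 1 / ((k : ℝ) + 1)) Filter.atTop
            (nhds (f x + 0)) := tendsto_const_nhds.add tendsto_one_div_add_atTop_nhds_zero_nat
        rw [add_zero] at h1
        exact h1.rpow_const (Or.inl (hf0 x).ne')
    have hcA : c * A < A := by
      calc c * A < 1 * A := ENNReal.mul_lt_mul_left hA0 hfin hc
        _ = A := one_mul A
    obtain ⟨k, hk⟩ := (hlim.eventually (lt_mem_nhds hcA)).exists
    refine ⟨1 / ((k : ℝ) + 1), ?_⟩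
    have ht : (0 : ℝ) < 1 / ((k : ℝ) + 1) := by positivity
    simp only [u, Set.indicator_of_mem (Set.mem_Ioi.2 ht)]
    rw [ENNReal.lt_div_iff_mul_lt (Or.inl hA0) (Or.inl hfin)]
    exact hk
  have hΦconv : ∀ {f : EuclideanSpace ℝ (Fin n) → ℝ}, (∀ x, 0 < f x) → ∀ t, 0 < t →
      Φ f t = ∫⁻ x, ENNReal.ofReal (f x + t) ^ (-(n : ℝ)) := by
    intro f hf0 t ht
    refine lintegral_congr fun x => ?_
    rw [ENNReal.ofReal_rpow_of_pos]
    have := hf0 x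
    linarith
  have main := lintegral_add_le_of_min_le (hum hg) (hum hW) (hum hQ) ?_ (hu_le hg0 rfl)
    (hu_le hW0 heq.symm) (hu_sup hg hg0 rfl) (hu_sup hW hW0 heq.symm)
  · rw [hu_int hg hg0, hu_int hW hW0, hu_int hQ hQ0, ← ENNReal.add_div, ← ENNReal.add_div] at main
    have hc0 : ENNReal.ofReal ((n : ℝ) - 1) ≠ 0 := by simpa using hn1
    rwa [ENNReal.div_le_iff hA0 hfin, ENNReal.div_mul_cancel hA0 hfin,
      ENNReal.div_le_iff hc0 ENNReal.ofReal_ne_top,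
      ENNReal.div_mul_cancel hc0 ENNReal.ofReal_ne_top] at main
  · intro s t
    by_cases hs : 0 < s
    · by_cases ht : 0 < t
      · have hst : 0 < s + t := by linarith
        simp only [u, Set.indicator_of_mem (Set.mem_Ioi.2 ht),
          Set.indicator_of_mem (Set.mem_Ioi.2 hs), Set.indicator_of_mem (Set.mem_Ioi.2 hst)]
        have hmono : Monotone fun a : ENNReal => a / A := fun a b hab => by
          simp only [div_eq_mul_inv]; exact mul_le_mul_left hab _
        rw [← hmono.map_min]
        refine hmono ?_
        rw [hΦconv hg0 s hs, hΦconv hW0 t ht, hΦconv hQ0 _ hst]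
        refine min_lintegral_rpow_neg_le_euclidean (by omega) (hg.add_const _).ennreal_ofReal
          (hW.add_const _).ennreal_ofReal (hQ.add_const _).ennreal_ofReal fun x y => ?_
        rw [← ENNReal.ofReal_add (by have := hg0 x; linarith) (by have := hW0 y; linarith)]
        refine ENNReal.ofReal_le_ofReal ?_
        have := h x y
        linarith
      · simp [u, Set.indicator_of_notMem (Set.notMem_Ioi.2 (not_lt.1 ht))]
    · simp [u, Set.indicator_of_notMem (Set.notMem_Ioi.2 (not_lt.1 hs))]

/-- The convex weight whose Legendre transform is `ξ ↦ ‖ξ‖ ^ p / p - 1 / q`. -/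
noncomputable def convexWeight {E : Type*} [NormedAddCommGroup E] (q : ℝ) (y : E) : ℝ :=
  (1 + ‖y‖ ^ q) / q

/-- The Hopf–Lax (infimal convolution) semigroup generated by `convexWeight q`. -/
noncomputable def hopfLax {E : Type*} [NormedAddCommGroup E] [NormedSpace ℝ E] (q : ℝ)
    (g : E → ℝ) (τ : ℝ) (z : E) : ℝ :=
  ⨅ y, (g (z - τ • y) + τ * convexWeight q y)

theorem one_add_rpow_le {r q : ℝ} (hr : 0 ≤ r) (hq : 0 ≤ q) :
    (1 + r) ^ q ≤ 2 ^ q * (1 + r ^ q) := by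
  have h1 : 1 + r ≤ 2 * max 1 r := by
    have := le_max_left 1 r
    have := le_max_right 1 r
    linarith
  have h2 : (max 1 r) ^ q ≤ 1 + r ^ q := by
    rcases max_cases 1 r with h | h <;> rw [h.1]
    · have := Real.rpow_nonneg hr q
      simpa using this
    · linarith
  calc (1 + r) ^ q ≤ (2 * max 1 r) ^ q := Real.rpow_le_rpow (by linarith) h1 hq
    _ = 2 ^ q * (max 1 r) ^ q := Real.mul_rpow (by norm_num) (by positivity)
    _ ≤ _ := by gcongr

section

variable {E : Type*} [NormedAddCommGroup E]

theorem convexWeight_pos {q : ℝ} (hq : 0 < q) (y : E) : 0 < convexWeight q y := by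
  unfold convexWeight; positivity

theorem continuous_convexWeight {q : ℝ} (hq : 0 < q) : Continuous (convexWeight q : E → ℝ) :=
  (continuous_const.add (continuous_norm.rpow_const fun _ => Or.inr hq.le)).div_const _

theorem le_convexWeight {q : ℝ} (hq : 0 < q) (y : E) :
    (1 / (2 ^ q * q)) * (1 + ‖y‖) ^ q ≤ convexWeight q y := by
  have h := one_add_rpow_le (norm_nonneg y) hq.le
  unfold convexWeight
  rw [le_div_iff₀ hq]
  calc 1 / (2 ^ q * q) * (1 + ‖y‖) ^ q * q = (1 + ‖y‖) ^ q / 2 ^ q := by field_simp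
    _ ≤ _ := by rw [div_le_iff₀ (by positivity)]; linarith

variable [NormedSpace ℝ E] {q : ℝ} {g : E → ℝ} {τ : ℝ}

theorem bddBelow_hopfLax (hq : 0 < q) (hg : ∀ x, 0 < g x) (hτ : 0 < τ) (z : E) :
    BddBelow (Set.range fun y => g (z - τ • y) + τ * convexWeight q y) := by
  refine ⟨0, ?_⟩
  rintro _ ⟨y, rfl⟩
  have := hg (z - τ • y)
  have := convexWeight_pos hq y
  positivity

theorem hopfLax_le (hq : 0 < q) (hg : ∀ x, 0 < g x) (hτ : 0 < τ) (z y : E) :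
    hopfLax q g τ z ≤ g (z - τ • y) + τ * convexWeight q y :=
  ciInf_le (bddBelow_hopfLax hq hg hτ z) y

theorem hopfLax_pos (hq : 0 < q) (hg : ∀ x, 0 < g x) (hτ : 0 < τ) (z : E) :
    0 < hopfLax q g τ z := by
  refine lt_of_lt_of_le (show 0 < τ * (1 / q) by positivity) (le_ciInf fun y => ?_)
  have h1 := hg (z - τ • y)
  have h2 : 1 / q ≤ convexWeight q y := by
    unfold convexWeight; gcongr; have := Real.rpow_nonneg (norm_nonneg y) q; linarith
  nlinarith

theorem measurable_hopfLax [MeasurableSpace E] [BorelSpace E] (hq : 0 < q) (hg : ∀ x, 0 < g x)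
    (hgc : Continuous g) (hτ : 0 < τ) : Measurable (hopfLax q g τ) := by
  refine UpperSemicontinuous.measurable (upperSemicontinuous_ciInf
    (fun z => bddBelow_hopfLax hq hg hτ z) fun y => Continuous.upperSemicontinuous ?_)
  fun_prop

theorem abs_sub_le_of_norm_fderiv_le {C s : ℝ} (hC : 0 ≤ C) (hs : 0 ≤ s)
    (hg : Differentiable ℝ g)
    (hg' : ∀ x, ‖fderiv ℝ g x‖ ≤ C * (1 + ‖x‖) ^ s) (hτ : 0 ≤ τ) (z y : E) :
    g z - g (z - τ • y) ≤ C * (1 + ‖z‖ + τ * ‖y‖) ^ s * (τ * ‖y‖) := by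
  have key := Convex.norm_image_sub_le_of_norm_fderiv_le (𝕜 := ℝ) (f := g)
    (s := Metric.closedBall 0 (‖z‖ + τ * ‖y‖)) (x := z - τ • y) (y := z)
    (C := C * (1 + ‖z‖ + τ * ‖y‖) ^ s) (fun x _ => hg x) (fun x hx => ?_)
    (convex_closedBall _ _) ?_ ?_
  · have e : ‖z - (z - τ • y)‖ = τ * ‖y‖ := by
      rw [sub_sub_cancel, norm_smul, Real.norm_of_nonneg hτ]
    rw [e] at key
    exact (le_abs_self _).trans key
  · refine (hg' x).trans ?_
    have hx' : ‖x‖ ≤ ‖z‖ + τ * ‖y‖ := by simpa using hx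
    have : 1 + ‖x‖ ≤ 1 + ‖z‖ + τ * ‖y‖ := by linarith
    exact mul_le_mul_of_nonneg_left (Real.rpow_le_rpow (by positivity) this hs) hC
  · rw [mem_closedBall_zero_iff]
    refine (norm_sub_le _ _).trans ?_
    rw [norm_smul, Real.norm_of_nonneg hτ]
  · rw [mem_closedBall_zero_iff]
    have : 0 ≤ τ * ‖y‖ := by positivity
    linarith

theorem exists_radius_le_add_mul_convexWeight {C : ℝ} (hC : 0 ≤ C) (hq : 1 < q)
    (hg : Differentiable ℝ g) (hg' : ∀ x, ‖fderiv ℝ g x‖ ≤ C * (1 + ‖x‖) ^ (q - 1)) :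
    ∃ R : ℝ, 1 ≤ R ∧ ∀ τ, 0 ≤ τ → τ ≤ 1 / R → ∀ z y : E, R * (1 + ‖z‖) ≤ ‖y‖ →
      g z + τ / q ≤ g (z - τ • y) + τ * convexWeight q y := by
  have hq1 : 0 < q - 1 := by linarith
  have hlim : Filter.Tendsto (fun R : ℝ => (R / 2) ^ (q - 1)) Filter.atTop Filter.atTop :=
    (tendsto_rpow_atTop hq1).comp (Filter.tendsto_id.atTop_div_const (by norm_num))
  obtain ⟨R, hR, hR1⟩ := ((hlim.eventually_ge_atTop (q * C)).and (Filter.eventually_ge_atTop 1)).exists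
  refine ⟨R, hR1, fun τ hτ hτR z y hy => ?_⟩
  have hR0 : 0 < R := by linarith
  have key := abs_sub_le_of_norm_fderiv_le hC hq1.le hg hg' hτ z y
  have h1 : 1 + ‖z‖ + τ * ‖y‖ ≤ ‖y‖ / (R / 2) := by
    have e1 : 1 + ‖z‖ ≤ ‖y‖ / R := by rw [le_div_iff₀ hR0]; linarith
    have e2 : τ * ‖y‖ ≤ 1 / R * ‖y‖ := by gcongr
    calc _ ≤ ‖y‖ / R + 1 / R * ‖y‖ := add_le_add e1 e2
      _ = _ := by field_simp; norm_num
  have h2 : C * (1 + ‖z‖ + τ * ‖y‖) ^ (q - 1) * (τ * ‖y‖) ≤ τ * (‖y‖ ^ q / q) := by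
    have hy0 : 0 ≤ ‖y‖ := norm_nonneg y
    have e3 : (1 + ‖z‖ + τ * ‖y‖) ^ (q - 1) ≤ ‖y‖ ^ (q - 1) / (R / 2) ^ (q - 1) := by
      rw [← Real.div_rpow hy0 (by positivity)]
      gcongr
    have e4 : ‖y‖ ^ q = ‖y‖ ^ (q - 1) * ‖y‖ := by
      have hy1 : 0 < ‖y‖ := lt_of_lt_of_le (by positivity) hy
      rw [Real.rpow_sub_one hy1.ne']
      field_simp
    have e5 : C / (R / 2) ^ (q - 1) ≤ 1 / q := by
      rw [div_le_div_iff₀ (by positivity) (by positivity)]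
      linarith
    calc C * (1 + ‖z‖ + τ * ‖y‖) ^ (q - 1) * (τ * ‖y‖)
        ≤ C * (‖y‖ ^ (q - 1) / (R / 2) ^ (q - 1)) * (τ * ‖y‖) := by gcongr
      _ = (C / (R / 2) ^ (q - 1)) * (τ * ‖y‖ ^ q) := by rw [e4]; ring
      _ ≤ 1 / q * (τ * ‖y‖ ^ q) := by gcongr
      _ = _ := by ring
  have e : τ * convexWeight q y = τ / q + τ * (‖y‖ ^ q / q) := by unfold convexWeight; ring
  rw [e]
  linarith

theorem exists_le_hopfLax {c C : ℝ} (hc : 0 < c) (hC : 0 ≤ C) (hq : 1 < q)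
    (hg : Differentiable ℝ g) (hgc : ∀ x, c * (1 + ‖x‖) ^ q ≤ g x)
    (hg' : ∀ x, ‖fderiv ℝ g x‖ ≤ C * (1 + ‖x‖) ^ (q - 1)) :
    ∃ K > 0, ∃ τ₀ > 0, ∀ τ, 0 < τ → τ < τ₀ → ∀ z : E, (1 - K * τ) * g z ≤ hopfLax q g τ z := by
  obtain ⟨R, hR1, hR⟩ := exists_radius_le_add_mul_convexWeight hC hq hg hg'
  have hR0 : 0 < R := by linarith
  refine ⟨C * 2 ^ (q - 1) * R / c + 1, by positivity, 1 / R, by positivity,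
    fun τ hτ hτR z => le_ciInf fun y => ?_⟩
  have hgz : 0 < g z := lt_of_lt_of_le (by positivity) (hgc z)
  rcases le_total (R * (1 + ‖z‖)) ‖y‖ with hy | hy
  · refine le_trans ?_ (hR τ hτ.le hτR.le z y hy)
    have : 0 < (C * 2 ^ (q - 1) * R / c + 1) * τ * g z := by positivity
    have : 0 < τ / q := by positivity
    linarith
  · have key := abs_sub_le_of_norm_fderiv_le hC (by linarith) hg hg' hτ.le z y
    have h1 : τ * ‖y‖ ≤ τ * R * (1 + ‖z‖) := by rw [mul_assoc]; gcongr
    have h2 : τ * R ≤ 1 := by rw [← le_div_iff₀ hR0]; exact hτR.le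
    have h3 : 1 + ‖z‖ + τ * ‖y‖ ≤ 2 * (1 + ‖z‖) := by
      have : τ * R * (1 + ‖z‖) ≤ 1 * (1 + ‖z‖) := by gcongr
      linarith
    have h4 : C * (1 + ‖z‖ + τ * ‖y‖) ^ (q - 1) * (τ * ‖y‖) ≤
        C * 2 ^ (q - 1) * R / c * τ * g z := by
      calc C * (1 + ‖z‖ + τ * ‖y‖) ^ (q - 1) * (τ * ‖y‖)
          ≤ C * (2 * (1 + ‖z‖)) ^ (q - 1) * (τ * R * (1 + ‖z‖)) := by gcongr
        _ = C * 2 ^ (q - 1) * R / c * τ * (c * (1 + ‖z‖) ^ q) := by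
            rw [Real.mul_rpow (by norm_num) (by positivity),
              Real.rpow_sub_one (by positivity : 1 + ‖z‖ ≠ 0)]
            field_simp
        _ ≤ _ := by gcongr; exact hgc z
    have h5 : 0 < τ * convexWeight q y := mul_pos hτ (convexWeight_pos (by linarith) y)
    have h6 : 0 < τ * g z := by positivity
    linarith

theorem eventually_le_hopfLax {p C : ℝ} (hpq : p.HolderConjugate q) (hC : 0 ≤ C)
    (hg : Differentiable ℝ g)
    (hg' : ∀ x, ‖fderiv ℝ g x‖ ≤ C * (1 + ‖x‖) ^ (q - 1)) (z : E) {η : ℝ} (hη : 0 < η) :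
    ∃ τ₀ > 0, ∀ τ, 0 < τ → τ < τ₀ →
      g z - τ * (‖fderiv ℝ g z‖ ^ p / p - 1 / q + η) ≤ hopfLax q g τ z := by
  have hq : 1 < q := hpq.symm.lt
  have hp : 1 < p := hpq.lt
  obtain ⟨R, hR1, hR⟩ := exists_radius_le_add_mul_convexWeight hC hq hg hg'
  have hR0 : 0 < R := by linarith
  have hM : 0 < R * (1 + ‖z‖) := by positivity
  have hd := (hg z).hasFDerivAt.isLittleO
  rw [Asymptotics.isLittleO_iff] at hd
  have hη' : 0 < η / (R * (1 + ‖z‖)) := by positivity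
  obtain ⟨δ, hδ, hball⟩ := Metric.eventually_nhds_iff.1 (hd hη')
  refine ⟨min (1 / R) (δ / (R * (1 + ‖z‖))), by positivity, fun τ hτ hτ0 => le_ciInf fun y => ?_⟩
  rcases le_total (R * (1 + ‖z‖)) ‖y‖ with hy | hy
  · refine le_trans ?_ (hR τ hτ.le (hτ0.le.trans (min_le_left _ _)) z y hy)
    have h1 : 0 ≤ τ * (‖fderiv ℝ g z‖ ^ p / p + η) := by positivity
    have h2 : τ * (1 / q) = τ / q := by ring
    linarith
  · have hn : ‖τ • y‖ = τ * ‖y‖ := by rw [norm_smul, Real.norm_of_nonneg hτ.le]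
    have h1 : τ * ‖y‖ < δ := by
      calc τ * ‖y‖ ≤ τ * (R * (1 + ‖z‖)) := by gcongr
        _ < δ / (R * (1 + ‖z‖)) * (R * (1 + ‖z‖)) := by
          gcongr; exact lt_of_lt_of_le hτ0 (min_le_right _ _)
        _ = δ := by field_simp
    have h2 := hball (y := z - τ • y) (by rw [dist_eq_norm, sub_sub_cancel_left, norm_neg, hn]; exact h1)
    rw [sub_sub_cancel_left, norm_neg, hn] at h2
    have h3 : η / (R * (1 + ‖z‖)) * (τ * ‖y‖) ≤ τ * η := by
      calc _ ≤ η / (R * (1 + ‖z‖)) * (τ * (R * (1 + ‖z‖))) := by gcongr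
        _ = _ := by field_simp
    have h4 := (abs_le.1 (h2.trans h3)).1
    simp only [map_neg, map_smul, smul_eq_mul] at h4
    have h5 : fderiv ℝ g z y ≤ ‖fderiv ℝ g z‖ ^ p / p + ‖y‖ ^ q / q :=
      (le_abs_self _).trans (((fderiv ℝ g z).le_opNorm y).trans
        (Real.young_inequality_of_nonneg (norm_nonneg _) (norm_nonneg _) hpq))
    have h6 := mul_le_mul_of_nonneg_left h5 hτ.le
    have e : τ * convexWeight q y = τ * (1 / q) + τ * (‖y‖ ^ q / q) := by unfold convexWeight; ring
    rw [e]
    linarith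

end

theorem integrable_rpow_neg_of_le {n : ℕ} {f : EuclideanSpace ℝ (Fin n) → ℝ} {c q s : ℝ}
    (hf : Measurable f) (hc : 0 < c) (hs : 0 ≤ s) (hqs : n < q * s)
    (hle : ∀ x, c * (1 + ‖x‖) ^ q ≤ f x) : Integrable fun x => f x ^ (-s) := by
  have h1 : Integrable (fun x : EuclideanSpace ℝ (Fin n) => c ^ (-s) * (1 + ‖x‖) ^ (-(q * s))) :=
    (integrable_one_add_norm (by simpa using hqs)).const_mul _
  refine h1.mono' (hf.pow_const _).aestronglyMeasurable (.of_forall fun x => ?_)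
  have h0 : 0 < c * (1 + ‖x‖) ^ q := by positivity
  have hf0 := h0.trans_le (hle x)
  rw [Real.norm_of_nonneg (by positivity)]
  calc f x ^ (-s) ≤ (c * (1 + ‖x‖) ^ q) ^ (-s) :=
        Real.rpow_le_rpow_of_nonpos h0 (hle x) (by linarith)
    _ = _ := by
        rw [Real.mul_rpow hc.le (by positivity), ← Real.rpow_mul (by positivity)]
        ring_nf

theorem one_sub_rpow_sub_le {A B ν : ℝ} (hA : 0 < A) (hB : 0 < B) (hν : 1 ≤ ν) :
    A ^ (1 - ν) - B ^ (1 - ν) ≤ (ν - 1) * A ^ (-ν) * (B - A) := by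
  have hr : 0 < B / A := by positivity
  have h1 : 1 + (1 - ν) * (B / A - 1) ≤ (B / A) ^ (1 - ν) := by
    rw [Real.rpow_def_of_pos hr]
    have h2 := Real.add_one_le_exp (Real.log (B / A) * (1 - ν))
    have h3 := Real.log_le_sub_one_of_pos hr
    nlinarith
  have h4 : A ^ (1 - ν) = A ^ (-ν) * A := by
    rw [← Real.rpow_add_one hA.ne']; ring_nf
  have h5 : B ^ (1 - ν) = A ^ (1 - ν) * (B / A) ^ (1 - ν) := by
    rw [← Real.mul_rpow hA.le hr.le]; congr 1; field_simp
  have h6 : 0 < A ^ (-ν) := by positivity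
  have h7 := mul_le_mul_of_nonneg_left h1 (by positivity : 0 ≤ A ^ (1 - ν))
  have h8 : A ^ (1 - ν) * (1 + (1 - ν) * (B / A - 1)) =
      A ^ (1 - ν) - (ν - 1) * A ^ (-ν) * (B - A) := by
    rw [h4]; field_simp; ring
  rw [h5]; linarith

section

variable {n : ℕ} {q c : ℝ} {g : EuclideanSpace ℝ (Fin n) → ℝ}

theorem integral_scale_rpow (W : EuclideanSpace ℝ (Fin n) → ℝ) (hW : ∀ y, 0 < W y) {τ : ℝ}
    (hτ : 0 < τ) (s : ℝ) :
    ∫ y, (τ * W (τ⁻¹ • y)) ^ s = τ ^ ((n : ℝ) + s) * ∫ y, W y ^ s := by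
  have h := Measure.integral_comp_inv_smul_of_nonneg (volume : Measure (EuclideanSpace ℝ (Fin n)))
    (fun y => (τ * W y) ^ s) hτ.le
  simp only [finrank_euclideanSpace_fin, smul_eq_mul] at h
  rw [h, Real.rpow_add hτ, Real.rpow_natCast, mul_assoc]
  congr 1
  rw [← integral_const_mul]
  exact integral_congr_ae (.of_forall fun y => Real.mul_rpow hτ.le (hW y).le)

theorem integrable_convexWeight_rpow_neg (hq : 0 < q) {s : ℝ} (hs : 0 ≤ s) (hqs : n < q * s) :
    Integrable fun y : EuclideanSpace ℝ (Fin n) => convexWeight q y ^ (-s) :=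
  integrable_rpow_neg_of_le (continuous_convexWeight hq).measurable
    (by positivity : 0 < 1 / (2 ^ q * q)) hs hqs (le_convexWeight hq)

theorem integral_rpow_add_le_integral_hopfLax (hn : 2 ≤ n) (hq : 1 < q) (hqn : n < q * (n - 1))
    (hc : 0 < c) (hgcont : Continuous g) (hgc : ∀ x, c * (1 + ‖x‖) ^ q ≤ g x)
    (hgW : ∫ x, g x ^ (-(n : ℝ)) = ∫ x : EuclideanSpace ℝ (Fin n), convexWeight q x ^ (-(n : ℝ)))
    {τ b : ℝ} (hτ : 0 < τ) (hb : 0 < b) (hQ : ∀ z, b * g z ≤ hopfLax q g τ z) :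
    (∫ x, g x ^ (1 - (n : ℝ))) + τ * ∫ x : EuclideanSpace ℝ (Fin n),
      convexWeight q x ^ (1 - (n : ℝ)) ≤ ∫ x, hopfLax q g τ x ^ (1 - (n : ℝ)) := by
  have hn' : (2 : ℝ) ≤ n := by exact_mod_cast hn
  have hq0 : 0 < q := by linarith
  have hg0 : ∀ x, 0 < g x := fun x => lt_of_lt_of_le (by positivity) (hgc x)
  set W : EuclideanSpace ℝ (Fin n) → ℝ := fun y => τ * convexWeight q (τ⁻¹ • y) with hWdef
  have hW0 : ∀ x, 0 < W x := fun x => mul_pos hτ (convexWeight_pos hq0 _)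
  have hWc : Continuous W :=
    continuous_const.mul ((continuous_convexWeight hq0).comp (continuous_const_smul _))
  have hQ0 := fun z => hopfLax_pos hq0 hg0 hτ z
  have hQm := measurable_hopfLax hq0 hg0 hgcont hτ
  have hqn' : n < q * n := by nlinarith
  have e1 : (1 : ℝ) - n = -((n : ℝ) - 1) := by ring
  have ig := integrable_rpow_neg_of_le (s := n) hgcont.measurable hc (by positivity) hqn' hgc
  have ig1 := integrable_rpow_neg_of_le (s := n - 1) hgcont.measurable hc (by linarith) hqn hgc
  have iQ1 := integrable_rpow_neg_of_le (s := n - 1) hQm (mul_pos hb hc) (by linarith) hqn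
    (fun x => by
      have h1 := mul_le_mul_of_nonneg_left (hgc x) hb.le
      have h2 := hQ x
      linarith)
  have iW : ∀ s : ℝ, 0 ≤ s → n < q * s → Integrable fun y => W y ^ (-s) := fun s hs hqs => by
    have h := ((integrable_convexWeight_rpow_neg (n := n) hq0 hs hqs).comp_smul
      (inv_ne_zero hτ.ne')).const_mul (τ ^ (-s))
    refine h.congr (.of_forall fun y => ?_)
    simp only [hWdef]
    rw [Real.mul_rpow hτ.le (convexWeight_pos hq0 _).le]
  have iWn := iW n (by positivity) hqn'
  have iW1 := iW (n - 1) (by linarith) hqn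
  rw [← e1] at ig1 iQ1 iW1
  have conv : ∀ {f : EuclideanSpace ℝ (Fin n) → ℝ} {s : ℝ}, (∀ x, 0 < f x) →
      Integrable (fun x => f x ^ s) →
      ∫⁻ x, ENNReal.ofReal (f x ^ s) = ENNReal.ofReal (∫ x, f x ^ s) := fun hf hi =>
    (ofReal_integral_eq_lintegral_ofReal hi
      (.of_forall fun x => Real.rpow_nonneg (hf x).le _)).symm
  have key := lintegral_rpow_one_sub_add_le hn hgcont.measurable hWc.measurable hQm hg0 hW0 hQ0
    (fun x y => by
      refine (hopfLax_le hq0 hg0 hτ (x + y) (τ⁻¹ • y)).trans_eq ?_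
      rw [smul_inv_smul₀ hτ.ne', add_sub_cancel_right])
    (by
      rw [conv hg0 ig, conv hW0 iWn, integral_scale_rpow _ (convexWeight_pos hq0) hτ, hgW]
      simp)
    (by rw [conv hg0 ig]; exact ENNReal.ofReal_ne_top)
  have nn : ∀ {f : EuclideanSpace ℝ (Fin n) → ℝ} {s : ℝ}, (∀ x, 0 < f x) →
      0 ≤ ∫ x, f x ^ s := fun hf => integral_nonneg fun x => Real.rpow_nonneg (hf x).le _
  rw [conv hg0 ig1, conv hW0 iW1, conv hQ0 iQ1, ← ENNReal.ofReal_add (nn hg0) (nn hW0),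
    ENNReal.ofReal_le_ofReal_iff (nn hQ0), integral_scale_rpow _ (convexWeight_pos hq0) hτ] at key
  simpa using key

end

section

variable {n : ℕ} {p q c C : ℝ} {g : EuclideanSpace ℝ (Fin n) → ℝ}

open Filter Topology in
theorem tendsto_max_hopfLax_slope (hn : 2 ≤ n) (hpq : p.HolderConjugate q) (hC : 0 ≤ C)
    (hg : Differentiable ℝ g) (hg0 : ∀ x, 0 < g x)
    (hg' : ∀ x, ‖fderiv ℝ g x‖ ≤ C * (1 + ‖x‖) ^ (q - 1)) (z : EuclideanSpace ℝ (Fin n)) :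
    Tendsto (fun τ => max ((hopfLax q g τ z ^ (1 - (n : ℝ)) - g z ^ (1 - (n : ℝ))) / τ)
      ((n - 1) * g z ^ (-(n : ℝ)) * (‖fderiv ℝ g z‖ ^ p / p - 1 / q))) (𝓝[>] 0)
      (𝓝 ((n - 1) * g z ^ (-(n : ℝ)) * (‖fderiv ℝ g z‖ ^ p / p - 1 / q))) := by
  have hn' : (2 : ℝ) ≤ n := by exact_mod_cast hn
  set ℓ := ‖fderiv ℝ g z‖ ^ p / p - 1 / q
  have hm : 0 < (n - 1) * g z ^ (-(n : ℝ)) :=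
    mul_pos (by linarith) (Real.rpow_pos_of_pos (hg0 z) _)
  refine tendsto_order.2 ⟨fun b hb => .of_forall fun τ => lt_max_of_lt_right hb, fun b hb => ?_⟩
  set η := (b - (n - 1) * g z ^ (-(n : ℝ)) * ℓ) / (2 * ((n - 1) * g z ^ (-(n : ℝ)))) with hη
  have hη0 : 0 < η := div_pos (by linarith) (by positivity)
  have hηb : (n - 1) * g z ^ (-(n : ℝ)) * (ℓ + η) < b := by
    have : (n - 1) * g z ^ (-(n : ℝ)) * η = (b - (n - 1) * g z ^ (-(n : ℝ)) * ℓ) / 2 := by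
      rw [hη]; field_simp; exact div_self hm.ne'
    rw [mul_add]; linarith
  obtain ⟨τ₀, hτ₀, hle⟩ := eventually_le_hopfLax hpq hC hg hg' z hη0
  have c1 : ContinuousAt (fun τ : ℝ => g z - τ * (ℓ + η)) 0 := by fun_prop
  have c2 : ContinuousAt (fun τ : ℝ => (n - 1) * (g z - τ * (ℓ + η)) ^ (-(n : ℝ)) * (ℓ + η)) 0 :=
    (continuousAt_const.mul (c1.rpow_const (Or.inl (by simpa using (hg0 z).ne')))).mul
      continuousAt_const
  have ev1 := c1.eventually (lt_mem_nhds (a := 0) (by simpa using hg0 z))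
  have ev2 := c2.eventually (gt_mem_nhds (a := b) (by simpa using hηb))
  filter_upwards [nhdsWithin_le_nhds ev1, nhdsWithin_le_nhds ev2, Ioo_mem_nhdsGT hτ₀]
    with τ h1 h2 h3
  refine max_lt (lt_of_le_of_lt ?_ h2) hb
  rw [div_le_iff₀ h3.1]
  have h4 : hopfLax q g τ z ^ (1 - (n : ℝ)) ≤ (g z - τ * (ℓ + η)) ^ (1 - (n : ℝ)) :=
    Real.rpow_le_rpow_of_nonpos h1 (hle τ h3.1 h3.2) (by linarith)
  have h5 := one_sub_rpow_sub_le h1 (hg0 z) (by linarith : (1 : ℝ) ≤ n)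
  rw [sub_sub_cancel] at h5
  linarith

open Filter Topology in
theorem integral_convexWeight_rpow_le (hn : 2 ≤ n) (hpq : p.HolderConjugate q)
    (hqn : n < q * (n - 1)) (hc : 0 < c) (hC : 0 ≤ C) (hg : Differentiable ℝ g)
    (hgc : ∀ x, c * (1 + ‖x‖) ^ q ≤ g x)
    (hg' : ∀ x, ‖fderiv ℝ g x‖ ≤ C * (1 + ‖x‖) ^ (q - 1))
    (hgW : ∫ x, g x ^ (-(n : ℝ)) = ∫ x : EuclideanSpace ℝ (Fin n), convexWeight q x ^ (-(n : ℝ))) :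
    ∫ x : EuclideanSpace ℝ (Fin n), convexWeight q x ^ (1 - (n : ℝ)) ≤
      ∫ x, (n - 1) * g x ^ (-(n : ℝ)) * (‖fderiv ℝ g x‖ ^ p / p - 1 / q) := by
  have hn' : (2 : ℝ) ≤ n := by exact_mod_cast hn
  have hn1 : (0 : ℝ) ≤ n - 1 := by linarith
  have hq : 1 < q := hpq.symm.lt
  have hq0 : 0 < q := by linarith
  have hp0 : 0 < p := by linarith [hpq.lt]
  have hg0 : ∀ x, 0 < g x := fun x => lt_of_lt_of_le (by positivity) (hgc x)
  obtain ⟨K, hK, τ₀, hτ₀, hKQ⟩ := exists_le_hopfLax hc hC hq hg hgc hg'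
  set L : EuclideanSpace ℝ (Fin n) → ℝ :=
    fun x => (n - 1) * g x ^ (-(n : ℝ)) * (‖fderiv ℝ g x‖ ^ p / p - 1 / q) with hL
  set D : ℝ → EuclideanSpace ℝ (Fin n) → ℝ :=
    fun τ x => (hopfLax q g τ x ^ (1 - (n : ℝ)) - g x ^ (1 - (n : ℝ))) / τ with hD
  have e1 : (1 : ℝ) - n = -((n : ℝ) - 1) := by ring
  have ig1 := integrable_rpow_neg_of_le (s := n - 1) hg.continuous.measurable hc hn1 hqn hgc
  rw [← e1] at ig1
  have hpow : ∀ x, g x ^ (1 - (n : ℝ)) = g x ^ (-(n : ℝ)) * g x := fun x => by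
    rw [← Real.rpow_add_one (hg0 x).ne']; ring_nf
  have hcg : ∀ x, c ≤ g x := fun x => by
    refine le_trans ?_ (hgc x)
    have : 1 ≤ (1 + ‖x‖) ^ q := Real.one_le_rpow (by simp) hq0.le
    nlinarith
  have hLb : ∀ x, |L x| ≤ (n - 1) * (C ^ p / (c * p) + 1 / (c * q)) * g x ^ (1 - (n : ℝ)) := by
    intro x
    have h1 : ‖fderiv ℝ g x‖ ^ p ≤ C ^ p / c * g x := by
      calc ‖fderiv ℝ g x‖ ^ p ≤ (C * (1 + ‖x‖) ^ (q - 1)) ^ p := by gcongr; exact hg' x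
        _ = C ^ p / c * (c * (1 + ‖x‖) ^ q) := by
          rw [Real.mul_rpow hC (by positivity), ← Real.rpow_mul (by positivity),
            hpq.symm.sub_one_mul_conj]
          field_simp
        _ ≤ _ := by gcongr; exact hgc x
    have h2 : |‖fderiv ℝ g x‖ ^ p / p - 1 / q| ≤ (C ^ p / (c * p) + 1 / (c * q)) * g x := by
      have h3 : 1 ≤ g x / c := by rw [le_div_iff₀ hc]; linarith [hcg x]
      have h4 : ‖fderiv ℝ g x‖ ^ p / p ≤ C ^ p / (c * p) * g x := by
        calc ‖fderiv ℝ g x‖ ^ p / p ≤ C ^ p / c * g x / p := by gcongr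
          _ = _ := by field_simp
      have h5 : 1 / q ≤ 1 / (c * q) * g x := by
        calc 1 / q = 1 / q * 1 := by ring
          _ ≤ 1 / q * (g x / c) := by gcongr
          _ = _ := by field_simp
      have h6 : 0 ≤ ‖fderiv ℝ g x‖ ^ p / p := by positivity
      have h7 : 0 < 1 / q := by positivity
      rw [abs_le]; constructor <;> linarith
    have h8 : 0 ≤ (n - 1) * g x ^ (-(n : ℝ)) := mul_nonneg hn1 (Real.rpow_nonneg (hg0 x).le _)
    rw [hL, abs_mul, abs_of_nonneg h8, hpow]
    calc _ ≤ (n - 1) * g x ^ (-(n : ℝ)) * ((C ^ p / (c * p) + 1 / (c * q)) * g x) := by gcongr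
      _ = _ := by ring
  have hsmall : ∀ᶠ τ in 𝓝[>] (0 : ℝ), 0 < τ ∧ (∀ z, 2⁻¹ * g z ≤ hopfLax q g τ z) ∧
      ∀ z, (1 - K * τ) * g z ≤ hopfLax q g τ z := by
    filter_upwards [Ioo_mem_nhdsGT (show 0 < min τ₀ (1 / (2 * K)) by positivity)] with τ hτ
    have h1 := fun z => hKQ τ hτ.1 (hτ.2.trans_le (min_le_left _ _)) z
    refine ⟨hτ.1, fun z => le_trans ?_ (h1 z), h1⟩
    have h2 : K * τ ≤ 2⁻¹ := by
      calc K * τ ≤ K * (1 / (2 * K)) := by gcongr; exact hτ.2.le.trans (min_le_right _ _)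
        _ = _ := by field_simp
    have := hg0 z
    gcongr
    linarith
  have hDb : ∀ τ, 0 < τ → (∀ z, 2⁻¹ * g z ≤ hopfLax q g τ z) →
      (∀ z, (1 - K * τ) * g z ≤ hopfLax q g τ z) → ∀ x,
      D τ x ≤ (n - 1) * ((2 : ℝ)⁻¹ ^ (-(n : ℝ)) * K) * g x ^ (1 - (n : ℝ)) := by
    intro τ hτ h1 h2 x
    have hQ0 : 0 < hopfLax q g τ x := hopfLax_pos hq0 hg0 hτ x
    have h3 := one_sub_rpow_sub_le hQ0 (hg0 x) (by linarith : (1 : ℝ) ≤ n)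
    have h4 : g x - hopfLax q g τ x ≤ K * τ * g x := by linarith [h2 x]
    have h5 : hopfLax q g τ x ^ (-(n : ℝ)) ≤ (2 : ℝ)⁻¹ ^ (-(n : ℝ)) * g x ^ (-(n : ℝ)) := by
      rw [← Real.mul_rpow (by norm_num) (hg0 x).le]
      exact Real.rpow_le_rpow_of_nonpos (by have := hg0 x; positivity) (h1 x) (by linarith)
    simp only [hD]
    rw [div_le_iff₀ hτ, hpow x]
    rw [hpow x] at h3
    have := hg0 x
    calc _ ≤ _ := h3
      _ ≤ (n - 1) * hopfLax q g τ x ^ (-(n : ℝ)) * (K * τ * g x) := by gcongr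
      _ ≤ (n - 1) * ((2 : ℝ)⁻¹ ^ (-(n : ℝ)) * g x ^ (-(n : ℝ))) * (K * τ * g x) := by gcongr
      _ = _ := by ring
  have hQm : ∀ τ, 0 < τ → Measurable (hopfLax q g τ) := fun τ hτ =>
    measurable_hopfLax hq0 hg0 hg.continuous hτ
  have hLm : Measurable L := by
    have := (measurable_fderiv ℝ g).norm
    have := hg.continuous.measurable
    fun_prop
  have hDm : ∀ τ, 0 < τ → Measurable (D τ) := fun τ hτ => by
    have := hQm τ hτ
    have := hg.continuous.measurable
    fun_prop
  set M := (n - 1) * ((2 : ℝ)⁻¹ ^ (-(n : ℝ)) * K) + (n - 1) * (C ^ p / (c * p) + 1 / (c * q))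
    with hM
  have hFb : ∀ τ, 0 < τ → (∀ z, 2⁻¹ * g z ≤ hopfLax q g τ z) →
      (∀ z, (1 - K * τ) * g z ≤ hopfLax q g τ z) → ∀ x,
      ‖max (D τ x) (L x)‖ ≤ M * g x ^ (1 - (n : ℝ)) := by
    intro τ hτ h1 h2 x
    have h3 := hDb τ hτ h1 h2 x
    have h4 := abs_le.1 (hLb x)
    have h5 : 0 ≤ g x ^ (1 - (n : ℝ)) := Real.rpow_nonneg (hg0 x).le _
    have h6 : 0 ≤ (n - 1) * ((2 : ℝ)⁻¹ ^ (-(n : ℝ)) * K) * g x ^ (1 - (n : ℝ)) := by positivity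
    have h7 : 0 ≤ (n - 1) * (C ^ p / (c * p) + 1 / (c * q)) * g x ^ (1 - (n : ℝ)) := by positivity
    rw [Real.norm_eq_abs, abs_le, hM, add_mul]
    exact ⟨by linarith [le_max_right (D τ x) (L x)], max_le (by linarith) (by linarith)⟩
  have hlim := tendsto_integral_filter_of_dominated_convergence (μ := volume) (l := 𝓝[>] (0 : ℝ))
    (F := fun τ x => max (D τ x) (L x)) (f := L) (fun x => M * g x ^ (1 - (n : ℝ)))
    (by
      filter_upwards [hsmall] with τ hτ
      exact ((hDm τ hτ.1).max hLm).aestronglyMeasurable)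
    (by
      filter_upwards [hsmall] with τ hτ
      exact .of_forall (hFb τ hτ.1 hτ.2.1 hτ.2.2))
    (ig1.const_mul _)
    (.of_forall fun x => tendsto_max_hopfLax_slope hn hpq hC hg hg0 hg' x)
  refine ge_of_tendsto hlim ?_
  filter_upwards [hsmall] with τ hτ
  have key := integral_rpow_add_le_integral_hopfLax hn hq hqn hc hg.continuous hgc hgW hτ.1
    (by norm_num : (0 : ℝ) < 2⁻¹) hτ.2.1
  have iQ1 := integrable_rpow_neg_of_le (s := n - 1) (hQm τ hτ.1)
    (mul_pos (by norm_num : (0 : ℝ) < 2⁻¹) hc) hn1 hqn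
    (fun x => by
      have h1 := hgc x
      have h2 := hτ.2.1 x
      linarith)
  rw [← e1] at iQ1
  have iF : Integrable fun x => max (D τ x) (L x) :=
    (ig1.const_mul M).mono' ((hDm τ hτ.1).max hLm).aestronglyMeasurable
      (.of_forall (hFb τ hτ.1 hτ.2.1 hτ.2.2))
  have iD : Integrable (D τ) := (iQ1.sub ig1).div_const τ
  calc ∫ x : EuclideanSpace ℝ (Fin n), convexWeight q x ^ (1 - (n : ℝ)) ≤ ∫ x, D τ x := by
        simp only [hD]
        rw [integral_div, integral_sub iQ1 ig1, le_div_iff₀ hτ.1]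
        linarith
    _ ≤ _ := integral_mono iD iF fun x => le_max_left _ _

end

theorem lt_conj_mul_sub_one {p q κ ν : ℝ} (hpq : p.HolderConjugate q) (hκ0 : 0 < κ)
    (hκ : (κ + 1) * p = κ * ν) : ν < q * (ν - 1) := by
  have h1 := hpq.sub_one_mul_conj
  have h2 := hpq.lt
  have h3 : p < ν := by
    have : κ * p < κ * ν := by linarith
    exact lt_of_mul_lt_mul_left this hκ0.le
  have h4 : 0 < (p - 1) * (q * (ν - 1) - ν) := by
    have : (p - 1) * (q * (ν - 1) - ν) = (p - 1) * q * (ν - 1) - (p - 1) * ν := by ring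
    rw [this, h1]; linarith
  have := pos_of_mul_pos_right h4 (by linarith)
  linarith

section

variable {E : Type*} [NormedAddCommGroup E] [InnerProductSpace ℝ E]

theorem norm_fderiv_radial [Nontrivial E] {F : ℝ → ℝ} {F' : ℝ} {x : E} (hx : x ≠ 0)
    (hF : HasDerivAt F F' ‖x‖) : ‖fderiv ℝ (fun y : E => F ‖y‖) x‖ = |F'| := by
  have hd : DifferentiableAt ℝ (fun y : E => ‖y‖) x :=
    (contDiffAt_norm ℝ (n := 1) hx).differentiableAt one_ne_zero
  have h := (hF.comp_hasFDerivAt x hd.hasFDerivAt).fderiv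
  have e : (F ∘ fun y : E => ‖y‖) = fun y : E => F ‖y‖ := rfl
  rw [e] at h
  rw [h, norm_smul, norm_fderiv_norm hd, mul_one, Real.norm_eq_abs]

theorem hasDerivAt_one_add_rpow {q s r : ℝ} (hr : 0 < r) :
    HasDerivAt (fun r : ℝ => (1 + r ^ q) ^ s) (s * q * r ^ (q - 1) * (1 + r ^ q) ^ (s - 1)) r := by
  have h1 := ((Real.hasDerivAt_rpow_const (p := q) (Or.inl hr.ne')).const_add 1).rpow_const
    (p := s) (Or.inl (by positivity))
  convert h1 using 1
  ring

theorem norm_fderiv_one_add_rpow [Nontrivial E] {q κ : ℝ} (hq : 0 < q) (hκ0 : 0 < κ) {x : E}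
    (hx : x ≠ 0) : ‖fderiv ℝ (fun y : E => (1 + ‖y‖ ^ q) ^ (-κ⁻¹)) x‖ =
      q / κ * ‖x‖ ^ (q - 1) * (1 + ‖x‖ ^ q) ^ (-κ⁻¹ - 1) := by
  have hx0 : 0 < ‖x‖ := norm_pos_iff.2 hx
  rw [norm_fderiv_radial hx (hasDerivAt_one_add_rpow (q := q) (s := -κ⁻¹) hx0), neg_mul, neg_mul,
    neg_mul, abs_neg, abs_of_nonneg (by positivity)]
  ring

theorem norm_fderiv_one_add_rpow_rpow [Nontrivial E] {p q κ ν : ℝ} (hpq : p.HolderConjugate q)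
    (hκ0 : 0 < κ) (hκ : (κ + 1) * p = κ * ν) {x : E} (hx : x ≠ 0) :
    ‖fderiv ℝ (fun y : E => (1 + ‖y‖ ^ q) ^ (-κ⁻¹)) x‖ ^ p =
      (q / κ) ^ p * (‖x‖ ^ q * (1 + ‖x‖ ^ q) ^ (-ν)) := by
  have hq : 0 < q := hpq.symm.pos
  rw [norm_fderiv_one_add_rpow hq hκ0 hx, Real.mul_rpow (by positivity) (by positivity),
    Real.mul_rpow (by positivity) (by positivity), ← Real.rpow_mul (by positivity),
    ← Real.rpow_mul (by positivity), hpq.symm.sub_one_mul_conj, mul_assoc]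
  congr 4
  have : (-κ⁻¹ - 1) * p = -(((κ + 1) * p) / κ) := by field_simp; ring
  rw [this, hκ]
  field_simp

end

section

variable {n : ℕ} {p q κ : ℝ}

theorem integrable_one_add_norm_rpow (hq : 0 < q) {s : ℝ} (hs : 0 ≤ s) (hqs : n < q * s) :
    Integrable fun x : EuclideanSpace ℝ (Fin n) => (1 + ‖x‖ ^ q) ^ (-s) := by
  refine integrable_rpow_neg_of_le (c := 1 / 2 ^ q) (q := q) ?_ (by positivity) hs hqs fun x => ?_
  · exact (continuous_const.add (continuous_norm.rpow_const fun _ => Or.inr hq.le)).measurable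
  · rw [div_mul_eq_mul_div, one_mul, div_le_iff₀ (by positivity), mul_comm]
    exact one_add_rpow_le (norm_nonneg x) hq.le

theorem one_add_norm_rpow_one_sub (q : ℝ) (ν : ℝ) {E : Type*} [NormedAddCommGroup E] (x : E) :
    (1 + ‖x‖ ^ q) ^ (1 - ν) = (1 + ‖x‖ ^ q) ^ (-ν) + ‖x‖ ^ q * (1 + ‖x‖ ^ q) ^ (-ν) := by
  have h : 0 < 1 + ‖x‖ ^ q := by positivity
  have : (1 + ‖x‖ ^ q) ^ (1 - ν) = (1 + ‖x‖ ^ q) ^ (-ν) * (1 + ‖x‖ ^ q) := by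
    rw [← Real.rpow_add_one h.ne']; ring_nf
  rw [this]; ring

theorem integrable_norm_rpow_mul (hn : 2 ≤ n) (hq : 1 < q) (hqn : n < q * (n - 1)) :
    Integrable fun x : EuclideanSpace ℝ (Fin n) => ‖x‖ ^ q * (1 + ‖x‖ ^ q) ^ (-(n : ℝ)) := by
  have hn' : (2 : ℝ) ≤ n := by exact_mod_cast hn
  have h1 := integrable_one_add_norm_rpow (n := n) (by linarith) (by linarith) hqn
  have h2 := integrable_one_add_norm_rpow (n := n) (q := q) (s := n) (by linarith) (by linarith)
    (by nlinarith)
  refine (h1.sub h2).congr (.of_forall fun x => ?_)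
  have := one_add_norm_rpow_one_sub q n x
  simp only [Pi.sub_apply]
  rw [show -((n : ℝ) - 1) = 1 - n by ring, this]
  ring

open Filter Topology in
theorem mul_integral_norm_rpow_mul (hn : 2 ≤ n) (hq : 1 < q) (hqn : n < q * (n - 1)) :
    q * (n - 1) * ∫ x : EuclideanSpace ℝ (Fin n), ‖x‖ ^ q * (1 + ‖x‖ ^ q) ^ (-(n : ℝ)) =
      n * ∫ x : EuclideanSpace ℝ (Fin n), (1 + ‖x‖ ^ q) ^ (1 - (n : ℝ)) := by
  have hn' : (2 : ℝ) ≤ n := by exact_mod_cast hn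
  have : Nonempty (Fin n) := ⟨⟨0, by omega⟩⟩
  have i1 := integrable_one_add_norm_rpow (n := n) (by linarith) (by linarith) hqn
  rw [show -((n : ℝ) - 1) = 1 - n by ring] at i1
  have i2 := integrable_norm_rpow_mul hn hq hqn
  set f : ℝ → ℝ := fun r => n * (1 + r ^ q) ^ (1 - (n : ℝ)) -
    q * (n - 1) * (r ^ q * (1 + r ^ q) ^ (-(n : ℝ))) with hf
  have hfi : Integrable fun x : EuclideanSpace ℝ (Fin n) => f ‖x‖ :=
    (i1.const_mul _).sub (i2.const_mul _)
  have h0 : ∫ x : EuclideanSpace ℝ (Fin n), f ‖x‖ = 0 := by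
    have hfi' := (integrable_fun_norm_addHaar volume).1 hfi
    rw [integral_fun_norm_addHaar]
    simp only [finrank_euclideanSpace_fin, smul_eq_mul] at hfi' ⊢
    have h1 := integral_Ioi_of_hasDerivAt_of_tendsto (a := 0) (m := 0)
      (f := fun r : ℝ => r ^ (n : ℝ) * (1 + r ^ q) ^ (1 - (n : ℝ)))
      (f' := fun r => r ^ (n - 1) * f r) ?_ ?_ hfi' ?_
    · rw [h1, Real.zero_rpow (by linarith)]; simp
    · refine ContinuousAt.continuousWithinAt ?_
      refine (Real.continuousAt_rpow_const _ _ (Or.inr (by linarith))).mul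
        ((continuousAt_const.add (Real.continuousAt_rpow_const _ _ (Or.inr (by linarith)))).rpow_const
          (Or.inl ?_))
      simp [Real.zero_rpow (show q ≠ 0 by linarith)]
    · intro r hr
      have hr0 : (0 : ℝ) < r := hr
      have h2 := (Real.hasDerivAt_rpow_const (p := (n : ℝ)) (Or.inl hr0.ne')).mul
        (hasDerivAt_one_add_rpow (q := q) (s := 1 - (n : ℝ)) hr0)
      refine h2.congr_deriv ?_
      have e1 : r ^ (n - 1) = r ^ ((n : ℝ) - 1) := by
        rw [← Real.rpow_natCast, Nat.cast_sub (by omega)]; simp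
      have e2 : r ^ (n : ℝ) = r ^ ((n : ℝ) - 1) * r := by
        rw [← Real.rpow_add_one hr0.ne']; ring_nf
      have e3 : r ^ q = r ^ (q - 1) * r := by
        rw [← Real.rpow_add_one hr0.ne']; ring_nf
      simp only [hf]
      rw [e1, e2, show (1 : ℝ) - n - 1 = -n by ring]
      linear_combination r ^ ((n : ℝ) - 1) * q * (n - 1) * (1 + r ^ q) ^ (-(n : ℝ)) * e3
    · have hlim := tendsto_rpow_neg_atTop (show 0 < q * ((n : ℝ) - 1) - n by linarith)
      refine squeeze_zero' (eventually_ge_atTop 0 |>.mono fun r hr => by positivity) ?_ hlim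
      filter_upwards [eventually_gt_atTop 0] with r hr
      calc r ^ (n : ℝ) * (1 + r ^ q) ^ (1 - (n : ℝ)) ≤ r ^ (n : ℝ) * (r ^ q) ^ (1 - (n : ℝ)) := by
            gcongr ?_ * ?_
            exact Real.rpow_le_rpow_of_nonpos (by positivity) (by linarith) (by linarith)
        _ = _ := by
            rw [← Real.rpow_mul hr.le, ← Real.rpow_add hr]; ring_nf
  simp only [hf] at h0
  rw [integral_sub (i1.const_mul _) (i2.const_mul _), integral_const_mul, integral_const_mul] at h0
  linarith

/-- The value of the Dirichlet energy of the profile `(1 + ‖x‖ ^ q) ^ (-κ⁻¹)`. -/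
theorem integral_norm_fderiv_one_add_rpow (hn : 2 ≤ n) (hpq : p.HolderConjugate q)
    (hκ0 : 0 < κ) (hκ : (κ + 1) * p = κ * n) :
    ∫ x : EuclideanSpace ℝ (Fin n), ‖fderiv ℝ (fun y : EuclideanSpace ℝ (Fin n) =>
      (1 + ‖y‖ ^ q) ^ (-κ⁻¹)) x‖ ^ p =
    (q / κ) ^ p * ∫ x : EuclideanSpace ℝ (Fin n), ‖x‖ ^ q * (1 + ‖x‖ ^ q) ^ (-(n : ℝ)) := by
  have : Nonempty (Fin n) := ⟨⟨0, by omega⟩⟩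
  rw [← integral_const_mul]
  refine integral_congr_ae ?_
  filter_upwards [Measure.ae_ne volume (0 : EuclideanSpace ℝ (Fin n))] with x hx
  exact norm_fderiv_one_add_rpow_rpow hpq hκ0 hκ hx

end

section

variable {n : ℕ} {p q κ c C : ℝ} {h : EuclideanSpace ℝ (Fin n) → ℝ}

theorem integral_norm_fderiv_ge_of_integral_eq (hn : 2 ≤ n) (hpq : p.HolderConjugate q)
    (hκ0 : 0 < κ) (hκ : (κ + 1) * p = κ * n) (hc : 0 < c) (hC : 0 < C)
    (hh : Differentiable ℝ h) (hlo : ∀ x, c * (1 + ‖x‖) ^ (-(q / κ)) ≤ h x)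
    (hup : ∀ x, h x ≤ C * (1 + ‖x‖) ^ (-(q / κ)))
    (hh' : ∀ x, ‖fderiv ℝ h x‖ ≤ C * (1 + ‖x‖) ^ (-(q / κ) - 1))
    (hmass : ∫ x, h x ^ (κ * n) =
      ∫ x : EuclideanSpace ℝ (Fin n), (1 + ‖x‖ ^ q) ^ (-(n : ℝ))) :
    (q / κ) ^ p * ∫ x : EuclideanSpace ℝ (Fin n), ‖x‖ ^ q * (1 + ‖x‖ ^ q) ^ (-(n : ℝ)) ≤
      ∫ x, ‖fderiv ℝ h x‖ ^ p := by
  have hn' : (2 : ℝ) ≤ n := by exact_mod_cast hn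
  have hq : 1 < q := hpq.symm.lt
  have hq0 : 0 < q := by linarith
  have hp : 1 < p := hpq.lt
  have hp0 : 0 < p := by linarith
  have hqn : n < q * (n - 1) := lt_conj_mul_sub_one hpq hκ0 hκ
  have h0 : ∀ x, 0 < h x := fun x => lt_of_lt_of_le (by positivity) (hlo x)
  have hx0 : ∀ x : EuclideanSpace ℝ (Fin n), 0 < 1 + ‖x‖ := fun x => by positivity
  set g : EuclideanSpace ℝ (Fin n) → ℝ := fun x => q⁻¹ * h x ^ (-κ) with hg
  have hgd : ∀ x, HasFDerivAt g ((-(κ / q) * h x ^ (-κ - 1)) • fderiv ℝ h x) x := fun x => by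
    have := (((hh x).hasFDerivAt.rpow_const (p := -κ) (Or.inl (h0 x).ne')).const_mul q⁻¹)
    rw [smul_smul] at this
    have e : q⁻¹ * (-κ * h x ^ (-κ - 1)) = -(κ / q) * h x ^ (-κ - 1) := by ring
    rwa [e] at this
  have hg'n : ∀ x, ‖fderiv ℝ g x‖ = κ / q * h x ^ (-κ - 1) * ‖fderiv ℝ h x‖ := fun x => by
    rw [(hgd x).fderiv, norm_smul, neg_mul, norm_neg, Real.norm_of_nonneg]
    have := h0 x
    positivity
  have hgc : ∀ x, q⁻¹ * C ^ (-κ) * (1 + ‖x‖) ^ q ≤ g x := fun x => by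
    have h1 : (C * (1 + ‖x‖) ^ (-(q / κ))) ^ (-κ) ≤ h x ^ (-κ) :=
      Real.rpow_le_rpow_of_nonpos (h0 x) (hup x) (by linarith)
    rw [Real.mul_rpow hC.le (by positivity), ← Real.rpow_mul (hx0 x).le, neg_mul_neg,
      div_mul_cancel₀ _ hκ0.ne'] at h1
    rw [mul_assoc]
    simp only [hg]
    gcongr
  have hg' : ∀ x, ‖fderiv ℝ g x‖ ≤ κ / q * c ^ (-κ - 1) * C * (1 + ‖x‖) ^ (q - 1) := fun x => by
    have h1 : h x ^ (-κ - 1) ≤ (c * (1 + ‖x‖) ^ (-(q / κ))) ^ (-κ - 1) :=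
      Real.rpow_le_rpow_of_nonpos (by positivity) (hlo x) (by linarith)
    have e : -(q / κ) * (-κ - 1) + (-(q / κ) - 1) = q - 1 := by field_simp; ring
    have hX := hx0 x
    have hhx := h0 x
    calc ‖fderiv ℝ g x‖ = _ := hg'n x
      _ ≤ κ / q * (c * (1 + ‖x‖) ^ (-(q / κ))) ^ (-κ - 1) *
          (C * (1 + ‖x‖) ^ (-(q / κ) - 1)) := by gcongr; exact hh' x
      _ = κ / q * c ^ (-κ - 1) * C *
          ((1 + ‖x‖) ^ (-(q / κ) * (-κ - 1)) * (1 + ‖x‖) ^ (-(q / κ) - 1)) := by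
        rw [Real.mul_rpow hc.le (by positivity), ← Real.rpow_mul hX.le]; ring
      _ = _ := by rw [← Real.rpow_add hX, e]
  have hgn : ∀ x, g x ^ (-(n : ℝ)) = q ^ (n : ℝ) * h x ^ (κ * n) := fun x => by
    have hhx := h0 x
    simp only [hg]
    rw [Real.mul_rpow (by positivity) (by positivity), ← Real.rpow_mul hhx.le, neg_mul_neg,
      Real.inv_rpow hq0.le, Real.rpow_neg hq0.le, inv_inv]
  have hWs : ∀ s : ℝ, ∫ x : EuclideanSpace ℝ (Fin n), convexWeight q x ^ s =
      q ^ (-s) * ∫ x : EuclideanSpace ℝ (Fin n), (1 + ‖x‖ ^ q) ^ s := fun s => by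
    rw [← integral_const_mul]
    refine integral_congr_ae (.of_forall fun x => ?_)
    simp only [convexWeight]
    rw [Real.div_rpow (by positivity) hq0.le, Real.rpow_neg hq0.le]
    ring
  have key := integral_convexWeight_rpow_le hn hpq hqn (by positivity) (by positivity)
    (fun x => (hgd x).differentiableAt) hgc hg'
    (by simp_rw [hgn]; rw [integral_const_mul, hmass, hWs, neg_neg])
  have hcont : Continuous h := hh.continuous
  have ig : Integrable fun x => h x ^ (κ * n) := by
    have hgm : Measurable g := by
      have := hcont.measurable
      fun_prop
    have := integrable_rpow_neg_of_le (s := n) hgm (by positivity) (by linarith) (by nlinarith) hgc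
    simp_rw [hgn] at this
    simpa [hq0.ne', (Real.rpow_pos_of_pos hq0 n).ne'] using this.const_mul (q ^ (n : ℝ))⁻¹
  have ih : Integrable fun x => ‖fderiv ℝ h x‖ ^ p := by
    have h1 : Integrable (fun x : EuclideanSpace ℝ (Fin n) =>
        C ^ p * (1 + ‖x‖) ^ (-((q / κ + 1) * p))) :=
      (integrable_one_add_norm (by
        have e : (q / κ + 1) * p = q * (n - 1) := by
          have h1 := hpq.mul_eq_add
          field_simp
          linear_combination q * hκ - κ * h1
        simpa [e] using hqn)).const_mul _
    refine h1.mono' (((measurable_fderiv ℝ h).norm.pow_const p).aestronglyMeasurable)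
      (.of_forall fun x => ?_)
    rw [Real.norm_of_nonneg (by positivity)]
    have hX := hx0 x
    calc ‖fderiv ℝ h x‖ ^ p ≤ (C * (1 + ‖x‖) ^ (-(q / κ) - 1)) ^ p := by gcongr; exact hh' x
      _ = _ := by
        rw [Real.mul_rpow hC.le (by positivity), ← Real.rpow_mul hX.le]
        ring_nf
  have hpt : ∀ x, (n - 1) * g x ^ (-(n : ℝ)) * (‖fderiv ℝ g x‖ ^ p / p - 1 / q) =
      (n - 1) * q ^ (n : ℝ) * ((κ / q) ^ p / p) * ‖fderiv ℝ h x‖ ^ p -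
        (n - 1) * q ^ (n : ℝ) * (1 / q) * h x ^ (κ * n) := fun x => by
    have hhx := h0 x
    have e : h x ^ (κ * n) * h x ^ ((-κ - 1) * p) = 1 := by
      rw [← Real.rpow_add hhx, ← hκ]; ring_nf; simp
    rw [hgn, hg'n, Real.mul_rpow (by positivity) (by positivity),
      Real.mul_rpow (by positivity) (by positivity), ← Real.rpow_mul hhx.le]
    linear_combination (n - 1) * q ^ (n : ℝ) * (κ / q) ^ p / p * ‖fderiv ℝ h x‖ ^ p * e
  simp_rw [hpt] at key
  rw [integral_sub (ih.const_mul _) (ig.const_mul _), integral_const_mul, integral_const_mul, hWs,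
    hmass] at key
  have i2 := integrable_norm_rpow_mul hn hq hqn
  have i1 := integrable_one_add_norm_rpow (n := n) (q := q) (s := n) hq0 (by linarith)
    (by nlinarith)
  have e1 : ∫ x : EuclideanSpace ℝ (Fin n), (1 + ‖x‖ ^ q) ^ (1 - (n : ℝ)) =
      (∫ x : EuclideanSpace ℝ (Fin n), (1 + ‖x‖ ^ q) ^ (-(n : ℝ))) +
      ∫ x : EuclideanSpace ℝ (Fin n), ‖x‖ ^ q * (1 + ‖x‖ ^ q) ^ (-(n : ℝ)) := by
    rw [← integral_add i1 i2]
    exact integral_congr_ae (.of_forall fun x => one_add_norm_rpow_one_sub q n x)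
  have e2 := mul_integral_norm_rpow_mul hn hq hqn
  rw [e1] at key e2
  set D := ∫ x : EuclideanSpace ℝ (Fin n), (1 + ‖x‖ ^ q) ^ (-(n : ℝ))
  set J := ∫ x : EuclideanSpace ℝ (Fin n), ‖x‖ ^ q * (1 + ‖x‖ ^ q) ^ (-(n : ℝ))
  set H := ∫ x, ‖fderiv ℝ h x‖ ^ p
  have hqq : 0 < q ^ (n : ℝ) := by positivity
  have hqs : q ^ (-(1 - (n : ℝ))) = q ^ (n : ℝ) / q := by
    rw [neg_sub, Real.rpow_sub_one hq0.ne']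
  rw [hqs] at key
  have k1 : D + J + (n - 1) * D ≤ (n - 1) * q * ((κ / q) ^ p / p) * H := by
    have : q ^ (n : ℝ) / q * (D + J + (n - 1) * D) ≤
        q ^ (n : ℝ) / q * ((n - 1) * q * ((κ / q) ^ p / p) * H) := by
      have e4 : q ^ (n : ℝ) / q * ((n - 1) * q * ((κ / q) ^ p / p) * H) =
        (n - 1) * q ^ (n : ℝ) * ((κ / q) ^ p / p) * H := by field_simp
      rw [e4]
      have e5 : q ^ (n : ℝ) / q * (D + J + (n - 1) * D) = q ^ (n : ℝ) / q * (D + J) +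
        (n - 1) * q ^ (n : ℝ) * (1 / q) * D := by ring
      rw [e5]; linarith
    exact le_of_mul_le_mul_left this (by positivity)
  have k2 : D + J + (n - 1) * D = (n - 1) * (q - 1) * J := by linear_combination -e2
  have k3 : (q - 1) * p = q := hpq.symm.sub_one_mul_conj
  rw [k2] at k1
  have k4 : (n - 1) * q * J ≤ (n - 1) * q * ((κ / q) ^ p * H) := by
    have := mul_le_mul_of_nonneg_left k1 hp0.le
    have e6 : p * ((n - 1) * q * ((κ / q) ^ p / p) * H) = (n - 1) * q * ((κ / q) ^ p * H) := by
      field_simp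
    have e7 : p * ((n - 1) * (q - 1) * J) = (n - 1) * q * J := by
      linear_combination (n - 1) * J * k3
    rw [e6, e7] at this
    exact this
  have k5 : J ≤ (κ / q) ^ p * H :=
    le_of_mul_le_mul_left k4 (mul_pos (by linarith) hq0)
  calc (q / κ) ^ p * J ≤ (q / κ) ^ p * ((κ / q) ^ p * H) := by gcongr
    _ = H := by
      rw [← mul_assoc, ← Real.mul_rpow (by positivity) (by positivity)]
      have : q / κ * (κ / q) = 1 := by field_simp
      rw [this, Real.one_rpow, one_mul]

end

/-- The Sobolev quotient of the profile `(1 + ‖x‖ ^ q) ^ (-κ⁻¹)`, in terms of two explicit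
radial integrals. -/
noncomputable def profileQuotient (n : ℕ) (p q κ : ℝ) : ℝ :=
  ((q / κ) ^ p * ∫ x : EuclideanSpace ℝ (Fin n), ‖x‖ ^ q * (1 + ‖x‖ ^ q) ^ (-(n : ℝ))) /
    (∫ x : EuclideanSpace ℝ (Fin n), (1 + ‖x‖ ^ q) ^ (-(n : ℝ))) ^ (p / (κ * n))

section

variable {n : ℕ} {p q κ c C : ℝ} {h : EuclideanSpace ℝ (Fin n) → ℝ}

theorem one_add_norm_decay_rpow {s t : ℝ} (hC : 0 ≤ C) {E : Type*} [NormedAddCommGroup E] (x : E) :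
    (C * (1 + ‖x‖) ^ (-s)) ^ t = C ^ t * (1 + ‖x‖) ^ (-(s * t)) := by
  rw [Real.mul_rpow hC (by positivity), ← Real.rpow_mul (by positivity), neg_mul]

theorem integrable_decay_rpow {s t : ℝ} (hC : 0 ≤ C) (hst : n < s * t) :
    Integrable fun x : EuclideanSpace ℝ (Fin n) => (C * (1 + ‖x‖) ^ (-s)) ^ t := by
  simp_rw [one_add_norm_decay_rpow hC]
  exact (integrable_one_add_norm (by simpa using hst)).const_mul _

theorem integrable_rpow_of_le_decay {s t : ℝ} {F : EuclideanSpace ℝ (Fin n) → ℝ}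
    (hF : Measurable F) (hC : 0 ≤ C) (ht : 0 ≤ t) (hst : n < s * t) (hF0 : ∀ x, 0 ≤ F x)
    (hle : ∀ x, F x ≤ C * (1 + ‖x‖) ^ (-s)) : Integrable fun x => F x ^ t := by
  refine (integrable_decay_rpow hC hst).mono' (hF.pow_const _).aestronglyMeasurable
    (.of_forall fun x => ?_)
  have := hF0 x
  rw [Real.norm_of_nonneg (by positivity)]
  gcongr
  exact hle x

theorem conj_div_add_one_mul (hpq : p.HolderConjugate q) (hκ0 : 0 < κ)
    (hκ : (κ + 1) * p = κ * n) : (q / κ + 1) * p = q * (n - 1) := by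
  have h1 := hpq.mul_eq_add
  field_simp
  linear_combination q * hκ - κ * h1

theorem integral_one_add_norm_rpow_pos (hn : 2 ≤ n) (hq : 1 < q) :
    0 < ∫ x : EuclideanSpace ℝ (Fin n), (1 + ‖x‖ ^ q) ^ (-(n : ℝ)) := by
  have hn' : (2 : ℝ) ≤ n := by exact_mod_cast hn
  refine integral_pos_of_integrable_nonneg_nonzero (x := 0) ?_
    (integrable_one_add_norm_rpow (by linarith) (by linarith) (by nlinarith))
    (fun x => by positivity) (by positivity)
  refine Continuous.rpow_const
    (continuous_const.add (continuous_norm.rpow_const fun _ => Or.inr (by linarith)))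
    fun x => Or.inl (by positivity)

theorem profileQuotient_mul_le (hn : 2 ≤ n) (hpq : p.HolderConjugate q)
    (hκ0 : 0 < κ) (hκ : (κ + 1) * p = κ * n) (hc : 0 < c) (hC : 0 < C)
    (hh : Differentiable ℝ h) (hlo : ∀ x, c * (1 + ‖x‖) ^ (-(q / κ)) ≤ h x)
    (hup : ∀ x, h x ≤ C * (1 + ‖x‖) ^ (-(q / κ)))
    (hh' : ∀ x, ‖fderiv ℝ h x‖ ≤ C * (1 + ‖x‖) ^ (-(q / κ) - 1)) :
    profileQuotient n p q κ * (∫ x, h x ^ (κ * n)) ^ (p / (κ * n)) ≤ ∫ x, ‖fderiv ℝ h x‖ ^ p := by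
  have hn' : (2 : ℝ) ≤ n := by exact_mod_cast hn
  have hq : 1 < q := hpq.symm.lt
  have hp0 : 0 < p := hpq.pos
  have h0 : ∀ x, 0 < h x := fun x => lt_of_lt_of_le (by positivity) (hlo x)
  have hκn : 0 < κ * n := by positivity
  have ih : Integrable fun x => h x ^ (κ * n) :=
    integrable_rpow_of_le_decay hh.continuous.measurable hC.le hκn.le (s := q / κ)
      (by field_simp; nlinarith) (fun x => (h0 x).le) hup
  have hA : 0 < ∫ x, h x ^ (κ * n) :=
    integral_pos_of_integrable_nonneg_nonzero (x := 0)
      (hh.continuous.rpow_const fun x => Or.inl (h0 x).ne') ih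
      (fun x => Real.rpow_nonneg (h0 x).le _) (Real.rpow_pos_of_pos (h0 0) _).ne'
  have hD := integral_one_add_norm_rpow_pos hn hq
  unfold profileQuotient
  set A := ∫ x, h x ^ (κ * n)
  set D := ∫ x : EuclideanSpace ℝ (Fin n), (1 + ‖x‖ ^ q) ^ (-(n : ℝ)) with hDdef
  set t := (D / A) ^ (κ * n)⁻¹ with ht
  have ht0 : 0 < t := by positivity
  have hder : ∀ x, ‖fderiv ℝ (fun y => t * h y) x‖ = t * ‖fderiv ℝ h x‖ := fun x => by
    rw [fderiv_const_mul (hh x), norm_smul, Real.norm_of_nonneg ht0.le]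
  have key := integral_norm_fderiv_ge_of_integral_eq (h := fun x => t * h x) (c := t * c)
    (C := t * C) hn hpq hκ0 hκ (by positivity) (by positivity) (hh.const_mul t)
    (fun x => by rw [mul_assoc]; gcongr; exact hlo x)
    (fun x => by rw [mul_assoc]; gcongr; exact hup x)
    (fun x => by rw [hder, mul_assoc]; gcongr; exact hh' x)
    (by
      simp_rw [fun x => Real.mul_rpow (z := κ * n) ht0.le (h0 x).le]
      rw [integral_const_mul, ht, ← Real.rpow_mul (by positivity), inv_mul_cancel₀ hκn.ne',
        Real.rpow_one]
      exact div_mul_cancel₀ _ hA.ne')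
  simp_rw [hder, fun x => Real.mul_rpow (z := p) ht0.le (norm_nonneg (fderiv ℝ h x))] at key
  rw [integral_const_mul, ht, ← Real.rpow_mul (by positivity), inv_mul_eq_div,
    Real.div_rpow hD.le hA.le] at key
  rw [div_mul_eq_mul_div, div_le_iff₀ (by positivity)]
  rw [div_mul_eq_mul_div, le_div_iff₀ (by positivity)] at key
  linarith

end

section

variable {E : Type*} [NormedAddCommGroup E]

theorem differentiableAt_sqrt_sq_add_sq [NormedSpace ℝ E] {f G : E → ℝ} {x : E}
    (hf : DifferentiableAt ℝ f x) (hG : DifferentiableAt ℝ G x) (h0 : 0 < G x) :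
    DifferentiableAt ℝ (fun y => √(f y ^ 2 + G y ^ 2)) x ∧
      ‖fderiv ℝ (fun y => √(f y ^ 2 + G y ^ 2)) x‖ ≤ ‖fderiv ℝ f x‖ + ‖fderiv ℝ G x‖ := by
  have hpos : 0 < f x ^ 2 + G x ^ 2 := by positivity
  have hs : 0 < √(f x ^ 2 + G x ^ 2) := Real.sqrt_pos.2 hpos
  have hd := ((hf.hasFDerivAt.pow 2).add (hG.hasFDerivAt.pow 2)).sqrt (by simpa using hpos.ne')
  have hd' : HasFDerivAt (fun y => √(f y ^ 2 + G y ^ 2))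
      ((f x / √(f x ^ 2 + G x ^ 2)) • fderiv ℝ f x +
        (G x / √(f x ^ 2 + G x ^ 2)) • fderiv ℝ G x) x := by
    refine hd.congr_fderiv ?_
    ext y
    simp only [Pi.add_apply, _root_.smul_apply, _root_.add_apply, smul_eq_mul, nsmul_eq_mul]
    field_simp
    simp
  refine ⟨hd'.differentiableAt, ?_⟩
  rw [hd'.fderiv]
  refine (norm_add_le _ _).trans ?_
  rw [norm_smul, norm_smul, Real.norm_eq_abs, Real.norm_eq_abs, abs_div, abs_div, abs_of_pos hs]
  have h1 : |f x| / √(f x ^ 2 + G x ^ 2) ≤ 1 := by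
    rw [div_le_one hs]; exact Real.abs_le_sqrt (by nlinarith)
  have h2 : |G x| / √(f x ^ 2 + G x ^ 2) ≤ 1 := by
    rw [div_le_one hs]; exact Real.abs_le_sqrt (by nlinarith)
  exact add_le_add (mul_le_of_le_one_left (norm_nonneg _) h1)
    (mul_le_of_le_one_left (norm_nonneg _) h2)

theorem one_add_sq_rpow_neg_le {s : ℝ} (hs : 0 ≤ s) (x : E) :
    (1 + ‖x‖ ^ 2) ^ (-s) ≤ 2 ^ s * (1 + ‖x‖) ^ (-(2 * s)) := by
  have h1 : (1 + ‖x‖) ^ (2 : ℝ) / 2 ≤ 1 + ‖x‖ ^ 2 := by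
    rw [Real.rpow_two]; nlinarith [sq_nonneg (1 - ‖x‖)]
  calc (1 + ‖x‖ ^ 2) ^ (-s) ≤ ((1 + ‖x‖) ^ (2 : ℝ) / 2) ^ (-s) :=
        Real.rpow_le_rpow_of_nonpos (by positivity) h1 (by linarith)
    _ = _ := by
        rw [Real.div_rpow (by positivity) (by norm_num), ← Real.rpow_mul (by positivity),
          Real.rpow_neg (by norm_num) s, div_inv_eq_mul, mul_comm]
        ring_nf

theorem le_one_add_sq_rpow_neg {s : ℝ} (hs : 0 ≤ s) (x : E) :
    (1 + ‖x‖) ^ (-(2 * s)) ≤ (1 + ‖x‖ ^ 2) ^ (-s) := by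
  have h1 : 1 + ‖x‖ ^ 2 ≤ (1 + ‖x‖) ^ (2 : ℝ) := by
    rw [Real.rpow_two]; nlinarith [norm_nonneg x]
  calc (1 + ‖x‖) ^ (-(2 * s)) = ((1 + ‖x‖) ^ (2 : ℝ)) ^ (-s) := by
        rw [← Real.rpow_mul (by positivity)]; ring_nf
    _ ≤ _ := Real.rpow_le_rpow_of_nonpos (by positivity) h1 (by linarith)

theorem exists_norm_le_decay {F : Type*} [NormedAddCommGroup F] {f : E → F}
    (hf : Continuous f) (hfs : HasCompactSupport f) (s : ℝ) :
    ∃ C, 0 < C ∧ ∀ x, ‖f x‖ ≤ C * (1 + ‖x‖) ^ s := by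
  have hc : Continuous fun x => ‖f x‖ * (1 + ‖x‖) ^ (-s) := by
    refine hf.norm.mul ((continuous_const.add continuous_norm).rpow_const fun x =>
      Or.inl (by positivity : (0 : ℝ) < 1 + ‖x‖).ne')
  obtain ⟨C, hC⟩ := (hfs.norm.mul_right (f' := fun x => (1 + ‖x‖) ^ (-s))).exists_bound_of_continuous hc
  refine ⟨max C 1, lt_max_of_lt_right one_pos, fun x => ?_⟩
  have h1 := (le_abs_self _).trans ((hC x).trans (le_max_left C 1))
  simp only [Pi.mul_apply] at h1
  rw [Real.rpow_neg (by positivity : (0 : ℝ) ≤ 1 + ‖x‖), ← div_eq_mul_inv, div_le_iff₀ (by positivity)] at h1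
  exact h1

variable [InnerProductSpace ℝ E]

theorem norm_fderiv_one_add_sq_rpow_le {s : ℝ} (hs : 0 ≤ s) (x : E) :
    DifferentiableAt ℝ (fun y : E => (1 + ‖y‖ ^ 2) ^ (-s)) x ∧
    ‖fderiv ℝ (fun y : E => (1 + ‖y‖ ^ 2) ^ (-s)) x‖ ≤
      2 * s * 2 ^ (s + 1 / 2) * (1 + ‖x‖) ^ (-(2 * s) - 1) := by
  have hpos : 0 < 1 + ‖x‖ ^ 2 := by positivity
  have hd := ((hasStrictFDerivAt_norm_sq x).hasFDerivAt.const_add 1).rpow_const (p := -s)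
    (Or.inl hpos.ne')
  refine ⟨hd.differentiableAt, ?_⟩
  rw [hd.fderiv, norm_smul, Real.norm_eq_abs, abs_mul, abs_neg, abs_of_nonneg hs,
    abs_of_pos (by positivity)]
  have h1 : ‖(2 : ℕ) • (innerSL ℝ) x‖ ≤ 2 * (1 + ‖x‖ ^ 2) ^ (1 / 2 : ℝ) := by
    refine (norm_nsmul_le ..).trans ?_
    rw [innerSL_apply_norm, ← Real.sqrt_eq_rpow]
    push_cast
    gcongr
    exact Real.le_sqrt_of_sq_le (by linarith)
  calc _ ≤ s * (1 + ‖x‖ ^ 2) ^ (-s - 1) * (2 * (1 + ‖x‖ ^ 2) ^ (1 / 2 : ℝ)) := by gcongr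
    _ = 2 * s * ((1 + ‖x‖ ^ 2) ^ (-s - 1) * (1 + ‖x‖ ^ 2) ^ (1 / 2 : ℝ)) := by ring
    _ = 2 * s * (1 + ‖x‖ ^ 2) ^ (-(s + 1 / 2)) := by
      rw [← Real.rpow_add hpos]; ring_nf
    _ ≤ 2 * s * (2 ^ (s + 1 / 2) * (1 + ‖x‖) ^ (-(2 * (s + 1 / 2)))) := by
      gcongr; exact one_add_sq_rpow_neg_le (by linarith) x
    _ = _ := by ring_nf

end

open Filter Topology in
theorem profileQuotient_mul_le_of_contDiff {n : ℕ} {p q κ : ℝ} (hn : 2 ≤ n)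
    (hpq : p.HolderConjugate q) (hκ0 : 0 < κ) (hκ : (κ + 1) * p = κ * n)
    {f : EuclideanSpace ℝ (Fin n) → ℝ} (hf : ContDiff ℝ 1 f) (hfs : HasCompactSupport f) :
    profileQuotient n p q κ * (∫ x, |f x| ^ (κ * n)) ^ (p / (κ * n)) ≤
      ∫ x, ‖fderiv ℝ f x‖ ^ p := by
  have hn' : (2 : ℝ) ≤ n := by exact_mod_cast hn
  have hq : 1 < q := hpq.symm.lt
  have hp0 : 0 < p := hpq.pos
  have hκn : 0 < κ * n := by positivity
  have hq0 : 0 < q := by linarith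
  have hfd : Differentiable ℝ f := hf.differentiable one_ne_zero
  set v : EuclideanSpace ℝ (Fin n) → ℝ := fun x => (1 + ‖x‖ ^ 2) ^ (-(q / κ / 2)) with hv
  have hs : 0 ≤ q / κ / 2 := by positivity
  have h2s : 2 * (q / κ / 2) = q / κ := by ring
  have hv0 : ∀ x, 0 < v x := fun x => by positivity
  have hvlo : ∀ x, (1 + ‖x‖) ^ (-(q / κ)) ≤ v x := fun x => by
    have := le_one_add_sq_rpow_neg hs x
    rwa [h2s] at this
  have hvup : ∀ x, v x ≤ 2 ^ (q / κ / 2) * (1 + ‖x‖) ^ (-(q / κ)) := fun x => by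
    have := one_add_sq_rpow_neg_le hs x
    rwa [h2s] at this
  have hvd : ∀ x, DifferentiableAt ℝ v x := fun x => (norm_fderiv_one_add_sq_rpow_le hs x).1
  set B := q / κ * 2 ^ (q / κ / 2 + 1 / 2) with hB
  have hB0 : 0 < B := by positivity
  have hv' : ∀ x, ‖fderiv ℝ v x‖ ≤ B * (1 + ‖x‖) ^ (-(q / κ) - 1) := fun x => by
    have := (norm_fderiv_one_add_sq_rpow_le hs x).2
    rwa [h2s] at this
  obtain ⟨C₁, hC₁, hf1⟩ := exists_norm_le_decay hf.continuous hfs (-(q / κ))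
  obtain ⟨C₂, hC₂, hf2⟩ := exists_norm_le_decay (hf.continuous_fderiv one_ne_zero)
    (hfs.fderiv ℝ) (-(q / κ) - 1)
  set M := C₁ + C₂ + 2 ^ (q / κ / 2) + B with hM
  have h2pos : (0 : ℝ) < 2 ^ (q / κ / 2) := by positivity
  have hM0 : 0 < M := by positivity
  have hgrad : ∀ δ, 0 < δ → δ ≤ 1 → ∀ x, ‖fderiv ℝ f x‖ + δ * ‖fderiv ℝ v x‖ ≤
      M * (1 + ‖x‖) ^ (-(q / κ) - 1) := fun δ hδ hδ1 x => by
    have h1 : δ * ‖fderiv ℝ v x‖ ≤ 1 * (B * (1 + ‖x‖) ^ (-(q / κ) - 1)) := by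
      gcongr; exact hv' x
    have h2 := hf2 x
    have h3 : 0 < (1 + ‖x‖) ^ (-(q / κ) - 1) := by positivity
    rw [hM]
    nlinarith
  have hst : n < (q / κ + 1) * p := by
    rw [conj_div_add_one_mul hpq hκ0 hκ]; exact lt_conj_mul_sub_one hpq hκ0 hκ
  have e1 : -(q / κ) - 1 = -(q / κ + 1) := by ring
  have key : ∀ δ, 0 < δ → δ ≤ 1 →
      profileQuotient n p q κ * (∫ x, |f x| ^ (κ * n)) ^ (p / (κ * n)) ≤
      ∫ x, (‖fderiv ℝ f x‖ + δ * ‖fderiv ℝ v x‖) ^ p := fun δ hδ hδ1 => by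
    set h : EuclideanSpace ℝ (Fin n) → ℝ := fun x => √(f x ^ 2 + (δ * v x) ^ 2) with hh
    have hδv : ∀ x, 0 < δ * v x := fun x => mul_pos hδ (hv0 x)
    have hd := fun x => differentiableAt_sqrt_sq_add_sq (hfd x) ((hvd x).const_mul δ) (hδv x)
    have hd2 : ∀ x, ‖fderiv ℝ h x‖ ≤ ‖fderiv ℝ f x‖ + δ * ‖fderiv ℝ v x‖ := fun x => by
      have := (hd x).2
      rwa [fderiv_const_mul (hvd x), norm_smul, Real.norm_of_nonneg hδ.le] at this
    have hfh : ∀ x, |f x| ≤ h x := fun x => Real.abs_le_sqrt (by nlinarith [hδv x])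
    have hlo : ∀ x, δ * (1 + ‖x‖) ^ (-(q / κ)) ≤ h x := fun x => by
      have h1 : δ * v x ≤ h x := Real.le_sqrt_of_sq_le (by nlinarith [sq_nonneg (f x)])
      refine le_trans ?_ h1
      gcongr
      exact hvlo x
    have hup : ∀ x, h x ≤ M * (1 + ‖x‖) ^ (-(q / κ)) := fun x => by
      have h1 : h x ≤ |f x| + δ * v x := by
        rw [hh]
        refine Real.sqrt_le_iff.2 ⟨by have := hδv x; positivity, ?_⟩
        have := mul_nonneg (abs_nonneg (f x)) (hδv x).le
        rw [← sq_abs (f x)]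
        nlinarith
      have h2 : δ * v x ≤ 1 * (2 ^ (q / κ / 2) * (1 + ‖x‖) ^ (-(q / κ))) := by
        gcongr; exact hvup x
      have h3 := hf1 x
      rw [Real.norm_eq_abs] at h3
      have h4 : 0 < (1 + ‖x‖) ^ (-(q / κ)) := by positivity
      rw [hM]
      nlinarith
    have hhd : Differentiable ℝ h := fun x => (hd x).1
    have hI : 0 ≤ profileQuotient n p q κ := by
      unfold profileQuotient
      have h1 : 0 ≤ ∫ x : EuclideanSpace ℝ (Fin n), ‖x‖ ^ q * (1 + ‖x‖ ^ q) ^ (-(n : ℝ)) :=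
        integral_nonneg fun x => by positivity
      have h2 := integral_one_add_norm_rpow_pos hn hq
      positivity
    have hh0 : ∀ x, 0 ≤ h x := fun x => Real.sqrt_nonneg _
    calc _ ≤ profileQuotient n p q κ * (∫ x, h x ^ (κ * n)) ^ (p / (κ * n)) := by
          gcongr ?_ * ?_ ^ _
          refine integral_mono_of_nonneg (.of_forall fun x => by positivity)
            (integrable_rpow_of_le_decay hhd.continuous.measurable hM0.le hκn.le (s := q / κ)
              (by field_simp; nlinarith) hh0 hup) (.of_forall fun x => ?_)
          have := hfh x
          simp only
          gcongr
      _ ≤ ∫ x, ‖fderiv ℝ h x‖ ^ p := profileQuotient_mul_le hn hpq hκ0 hκ hδ hM0 hhd hlo hup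
          fun x => (hd2 x).trans (hgrad δ hδ hδ1 x)
      _ ≤ _ := by
        refine integral_mono_of_nonneg (.of_forall fun x => by positivity)
          (integrable_rpow_of_le_decay (C := M) (s := q / κ + 1)
            (F := fun x => ‖fderiv ℝ f x‖ + δ * ‖fderiv ℝ v x‖)
            (((measurable_fderiv ℝ f).norm).add ((measurable_fderiv ℝ v).norm.const_mul δ))
            hM0.le hp0.le hst (fun x => by positivity) fun x => ?_) (.of_forall fun x => ?_)
        · rw [← e1]; exact hgrad δ hδ hδ1 x
        · have := hd2 x
          simp only
          gcongr
  have hlim : Tendsto (fun δ : ℝ => ∫ x, (‖fderiv ℝ f x‖ + δ * ‖fderiv ℝ v x‖) ^ p) (𝓝[>] 0)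
      (𝓝 (∫ x, ‖fderiv ℝ f x‖ ^ p)) := by
    have hev : ∀ᶠ δ in 𝓝[>] (0 : ℝ), 0 < δ ∧ δ ≤ 1 :=
      (Ioc_mem_nhdsGT one_pos : Set.Ioc (0 : ℝ) 1 ∈ 𝓝[>] 0)
    refine tendsto_integral_filter_of_dominated_convergence
      (fun x => (M * (1 + ‖x‖) ^ (-(q / κ + 1))) ^ p) ?_ ?_ (integrable_decay_rpow hM0.le hst) ?_
    · refine .of_forall fun δ => Measurable.aestronglyMeasurable ?_
      exact (((measurable_fderiv ℝ f).norm).add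
        ((measurable_fderiv ℝ v).norm.const_mul δ)).pow_const _
    · filter_upwards [hev] with δ hδ
      refine .of_forall fun x => ?_
      have h1 := hgrad δ hδ.1 hδ.2 x
      have h2 := hδ.1
      rw [Real.norm_of_nonneg (by positivity), ← e1]
      gcongr
    · refine .of_forall fun x => ?_
      have : ContinuousAt (fun δ : ℝ => (‖fderiv ℝ f x‖ + δ * ‖fderiv ℝ v x‖) ^ p) 0 :=
        ContinuousAt.rpow_const (by fun_prop) (Or.inr hp0.le)
      have h1 := this.tendsto.mono_left (nhdsWithin_le_nhds (s := Set.Ioi 0))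
      simpa using h1
  refine ge_of_tendsto hlim ?_
  filter_upwards [Ioc_mem_nhdsGT (one_pos : (0 : ℝ) < 1)] with δ hδ
  exact key δ hδ.1 hδ.2

/-- A regularization (smooth for `t ≠ 0`) of the profile `(1 + ‖x‖ ^ q) ^ (-κ⁻¹)`. -/
noncomputable def regProfile {E : Type*} [NormedAddCommGroup E] (q κ t : ℝ) (x : E) : ℝ :=
  (1 + (t ^ 2 + ‖x‖ ^ 2) ^ (q / 2)) ^ (-κ⁻¹)

section

variable {E : Type*} [NormedAddCommGroup E] {p q κ : ℝ}

theorem sq_rpow_half {r : ℝ} (hr : 0 ≤ r) (q : ℝ) : (r ^ 2) ^ (q / 2) = r ^ q := by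
  rw [← Real.rpow_natCast_mul hr]; congr 1; push_cast; ring

theorem regProfile_zero (q κ : ℝ) (x : E) :
    regProfile q κ 0 x = (1 + ‖x‖ ^ q) ^ (-κ⁻¹) := by
  rw [regProfile, zero_pow two_ne_zero, zero_add, sq_rpow_half (norm_nonneg x)]

theorem regProfile_pos (q κ t : ℝ) (x : E) : 0 < regProfile q κ t x := by
  unfold regProfile; positivity

theorem one_add_reg_rpow_neg_le (hq : 0 < q) {β : ℝ} (hβ : 0 ≤ β) (t : ℝ) (x : E) :
    (1 + (t ^ 2 + ‖x‖ ^ 2) ^ (q / 2)) ^ (-β) ≤ 2 ^ (q * β) * (1 + ‖x‖) ^ (-(q * β)) := by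
  have h1 : (1 + ‖x‖) ^ q / 2 ^ q ≤ 1 + (t ^ 2 + ‖x‖ ^ 2) ^ (q / 2) := by
    rw [div_le_iff₀ (by positivity), mul_comm]
    refine (one_add_rpow_le (norm_nonneg x) hq.le).trans ?_
    rw [← sq_rpow_half (norm_nonneg x) q]
    gcongr
    nlinarith [sq_nonneg t]
  calc _ ≤ ((1 + ‖x‖) ^ q / 2 ^ q) ^ (-β) :=
        Real.rpow_le_rpow_of_nonpos (by positivity) h1 (by linarith)
    _ = _ := by
        rw [Real.div_rpow (by positivity) (by positivity), ← Real.rpow_mul (by positivity),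
          ← Real.rpow_mul (by positivity), mul_neg, Real.rpow_neg (by norm_num : (0 : ℝ) ≤ 2),
          div_inv_eq_mul, mul_comm]

theorem regProfile_le (hq : 0 < q) (hκ0 : 0 < κ) (t : ℝ) (x : E) :
    regProfile q κ t x ≤ 2 ^ (q / κ) * (1 + ‖x‖) ^ (-(q / κ)) :=
  one_add_reg_rpow_neg_le hq (by positivity) t x

open Filter Topology in
theorem tendsto_regProfile (hq : 0 < q) (x : E) :
    Tendsto (fun t => regProfile q κ t x) (𝓝 0) (𝓝 (regProfile q κ 0 x)) := by
  unfold regProfile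
  have h : ContinuousAt (fun t : ℝ => 1 + (t ^ 2 + ‖x‖ ^ 2) ^ (q / 2)) 0 :=
    continuousAt_const.add (ContinuousAt.rpow_const (by fun_prop) (Or.inr (by positivity)))
  exact (h.rpow_const (Or.inl (by positivity))).tendsto

variable [InnerProductSpace ℝ E]

theorem contDiff_regProfile (q κ : ℝ) {t : ℝ} (ht : t ≠ 0) {m : WithTop ℕ∞} :
    ContDiff ℝ m (regProfile q κ t : E → ℝ) := by
  unfold regProfile
  refine ContDiff.rpow_const_of_ne (contDiff_const.add (ContDiff.rpow_const_of_ne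
    (contDiff_const.add (contDiff_norm_sq ℝ)) fun x => ?_)) fun x => ?_ <;> positivity

theorem hasFDerivAt_regProfile (q κ t : ℝ) {x : E} (h : 0 < t ^ 2 + ‖x‖ ^ 2) :
    HasFDerivAt (regProfile q κ t) ((-κ⁻¹ * (1 + (t ^ 2 + ‖x‖ ^ 2) ^ (q / 2)) ^ (-κ⁻¹ - 1) *
      (q / 2 * (t ^ 2 + ‖x‖ ^ 2) ^ (q / 2 - 1))) • (2 • innerSL ℝ x)) x := by
  have h1 := (((hasStrictFDerivAt_norm_sq x).hasFDerivAt.const_add (t ^ 2)).rpow_const (p := q / 2)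
    (Or.inl h.ne')).const_add 1
  have h2 := h1.rpow_const (p := -κ⁻¹) (Or.inl (by positivity))
  rw [smul_smul] at h2
  exact h2

theorem norm_fderiv_regProfile_le (hq : 1 < q) (hκ0 : 0 < κ) (t : ℝ) {x : E}
    (h : 0 < t ^ 2 + ‖x‖ ^ 2) : ‖fderiv ℝ (regProfile q κ t) x‖ ≤
      q / κ * 2 ^ (q / κ + 1) * (1 + ‖x‖) ^ (-(q / κ + 1)) := by
  have hq0 : 0 < q := by linarith
  rw [(hasFDerivAt_regProfile q κ t h).fderiv, norm_smul, neg_mul, neg_mul, norm_neg,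
    Real.norm_of_nonneg (by positivity)]
  set s := t ^ 2 + ‖x‖ ^ 2 with hs
  have h1 : ‖(2 : ℕ) • (innerSL ℝ) x‖ ≤ 2 * s ^ (1 / 2 : ℝ) := by
    refine (norm_nsmul_le ..).trans ?_
    rw [innerSL_apply_norm, ← Real.sqrt_eq_rpow]
    push_cast
    gcongr
    exact Real.le_sqrt_of_sq_le (by nlinarith [sq_nonneg t])
  have h2 : s ^ (q / 2 - 1) * s ^ (1 / 2 : ℝ) ≤ (1 + s ^ (q / 2)) ^ ((q - 1) / q) := by
    have : s ^ (q / 2 - 1) * s ^ (1 / 2 : ℝ) = (s ^ (q / 2)) ^ ((q - 1) / q) := by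
      rw [← Real.rpow_add h, ← Real.rpow_mul h.le]
      congr 1
      field_simp
      ring
    rw [this]
    have hq1 : 0 ≤ q - 1 := by linarith
    gcongr
    linarith
  have hV : 0 < 1 + s ^ (q / 2) := by positivity
  calc κ⁻¹ * (1 + s ^ (q / 2)) ^ (-κ⁻¹ - 1) * (q / 2 * s ^ (q / 2 - 1)) * ‖(2 : ℕ) • (innerSL ℝ) x‖
      ≤ κ⁻¹ * (1 + s ^ (q / 2)) ^ (-κ⁻¹ - 1) * (q / 2 * s ^ (q / 2 - 1)) *
        (2 * s ^ (1 / 2 : ℝ)) := by gcongr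
    _ = q / κ * ((1 + s ^ (q / 2)) ^ (-κ⁻¹ - 1) * (s ^ (q / 2 - 1) * s ^ (1 / 2 : ℝ))) := by ring
    _ ≤ q / κ * ((1 + s ^ (q / 2)) ^ (-κ⁻¹ - 1) * (1 + s ^ (q / 2)) ^ ((q - 1) / q)) := by gcongr
    _ = q / κ * (1 + s ^ (q / 2)) ^ (-(κ⁻¹ + 1 / q)) := by
      rw [← Real.rpow_add hV]
      congr 2
      field_simp
      ring
    _ ≤ q / κ * (2 ^ (q * (κ⁻¹ + 1 / q)) * (1 + ‖x‖) ^ (-(q * (κ⁻¹ + 1 / q)))) := by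
      gcongr
      exact one_add_reg_rpow_neg_le hq0 (by positivity) t x
    _ = _ := by
      have : q * (κ⁻¹ + 1 / q) = q / κ + 1 := by field_simp
      rw [this]; ring

open Filter Topology in
theorem tendsto_fderiv_regProfile {x : E} (hx : x ≠ 0) :
    Tendsto (fun t => fderiv ℝ (regProfile q κ t) x) (𝓝 0)
      (𝓝 (fderiv ℝ (regProfile q κ 0) x)) := by
  have hx0 : 0 < ‖x‖ := norm_pos_iff.2 hx
  simp_rw [fun t => (hasFDerivAt_regProfile q κ t (by positivity : 0 < t ^ 2 + ‖x‖ ^ 2)).fderiv]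
  have h0 : ContinuousAt (fun t : ℝ => t ^ 2 + ‖x‖ ^ 2) 0 := by fun_prop
  have hne : (0 : ℝ) ^ 2 + ‖x‖ ^ 2 ≠ 0 := by positivity
  have h1 : ContinuousAt (fun t : ℝ => 1 + (t ^ 2 + ‖x‖ ^ 2) ^ (q / 2)) 0 :=
    continuousAt_const.add (h0.rpow_const (Or.inl hne))
  exact (((continuousAt_const.mul (h1.rpow_const (Or.inl (by positivity)))).mul
    (continuousAt_const.mul (h0.rpow_const (Or.inl hne)))).smul continuousAt_const).tendsto

end

open Filter Topology in
theorem exists_seq_contDiff_tendsto_profile {n : ℕ} {p q κ : ℝ} (hn : 2 ≤ n)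
    (hpq : p.HolderConjugate q) (hκ0 : 0 < κ) (hκ : (κ + 1) * p = κ * n) :
    ∃ φ : ℝ → EuclideanSpace ℝ (Fin n) → ℝ,
      (∀ t, 0 < t → ContDiff ℝ (⊤ : ℕ∞) (φ t) ∧ HasCompactSupport (φ t) ∧ φ t ≠ 0) ∧
      Tendsto (fun t => ∫ x, |φ t x| ^ (κ * n)) (𝓝[>] 0)
        (𝓝 (∫ x : EuclideanSpace ℝ (Fin n), (1 + ‖x‖ ^ q) ^ (-(n : ℝ)))) ∧
      Tendsto (fun t => ∫ x, ‖fderiv ℝ (φ t) x‖ ^ p) (𝓝[>] 0)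
        (𝓝 ((q / κ) ^ p *
          ∫ x : EuclideanSpace ℝ (Fin n), ‖x‖ ^ q * (1 + ‖x‖ ^ q) ^ (-(n : ℝ)))) := by
  have hn' : (2 : ℝ) ≤ n := by exact_mod_cast hn
  have : Nonempty (Fin n) := ⟨⟨0, by omega⟩⟩
  have hq : 1 < q := hpq.symm.lt
  have hq0 : 0 < q := by linarith
  have hp0 : 0 < p := hpq.pos
  have hκn : 0 < κ * n := by positivity
  let χ : ContDiffBump (0 : EuclideanSpace ℝ (Fin n)) := ⟨1, 2, one_pos, one_lt_two⟩
  have hχd : Differentiable ℝ χ := χ.contDiff (n := 1).differentiable one_ne_zero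
  obtain ⟨M, hM⟩ := (χ.hasCompactSupport.fderiv ℝ).exists_bound_of_continuous
    ((χ.contDiff (n := 1)).continuous_fderiv one_ne_zero)
  have hM0 : 0 ≤ M := (norm_nonneg _).trans (hM 0)
  set φ : ℝ → EuclideanSpace ℝ (Fin n) → ℝ := fun t x => χ (t • x) * regProfile q κ t x with hφ
  have hχ' : ∀ t x, fderiv ℝ (fun y => χ (t • y)) x = t • fderiv ℝ χ (t • x) :=
    fun t x => fderiv_comp_smul t
  have hfd : ∀ t, 0 < t → ∀ x, fderiv ℝ (φ t) x = χ (t • x) • fderiv ℝ (regProfile q κ t) x +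
      regProfile q κ t x • t • fderiv ℝ χ (t • x) := fun t ht x => by
    have h1 : DifferentiableAt ℝ (fun y => χ (t • y)) x :=
      (hχd _).comp x (differentiableAt_id.const_smul t)
    have h2 : DifferentiableAt ℝ (regProfile q κ t) x :=
      ((contDiff_regProfile q κ ht.ne' (m := 1)).differentiable one_ne_zero) x
    rw [← hχ']
    exact fderiv_mul h1 h2
  have hφd : ∀ t, 0 < t → ContDiff ℝ (⊤ : ℕ∞) (φ t) := fun t ht =>
    (χ.contDiff.comp (contDiff_id.const_smul t)).mul (contDiff_regProfile q κ ht.ne')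
  have hev : ∀ᶠ t in 𝓝[>] (0 : ℝ), 0 < t ∧ t ≤ 1 :=
    (Ioc_mem_nhdsGT one_pos : Set.Ioc (0 : ℝ) 1 ∈ 𝓝[>] 0)
  have hφle : ∀ t x, |φ t x| ≤ 2 ^ (q / κ) * (1 + ‖x‖) ^ (-(q / κ)) := fun t x => by
    have h1 := regProfile_pos q κ t x
    simp only [hφ]
    rw [abs_mul, abs_of_nonneg χ.nonneg, abs_of_pos h1]
    exact (mul_le_of_le_one_left h1.le χ.le_one).trans (regProfile_le hq0 hκ0 t x)
  set B := q / κ * 2 ^ (q / κ + 1) + 2 ^ (q / κ) * M * 3 with hB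
  have hB0 : 0 ≤ B := by positivity
  have hgle : ∀ t, 0 < t → t ≤ 1 → ∀ x, ‖fderiv ℝ (φ t) x‖ ≤ B * (1 + ‖x‖) ^ (-(q / κ + 1)) := by
    intro t ht ht1 x
    rw [hfd t ht]
    refine (norm_add_le _ _).trans ?_
    have h1 := norm_fderiv_regProfile_le hq hκ0 t (by positivity : 0 < t ^ 2 + ‖x‖ ^ 2)
    have h2 : ‖χ (t • x) • fderiv ℝ (regProfile q κ t) x‖ ≤ ‖fderiv ℝ (regProfile q κ t) x‖ := by
      rw [norm_smul, Real.norm_of_nonneg χ.nonneg]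
      exact mul_le_of_le_one_left (norm_nonneg _) χ.le_one
    have h3 : t * ‖fderiv ℝ χ (t • x)‖ ≤ M * (3 / (1 + ‖x‖)) := by
      by_cases hx : t * ‖x‖ ≤ 2
      · have h4 : t ≤ 3 / (1 + ‖x‖) := by
          rw [le_div_iff₀ (by positivity)]; linarith
        calc _ ≤ 3 / (1 + ‖x‖) * M := by gcongr; exact hM _
          _ = _ := mul_comm _ _
      · have h5 : fderiv ℝ χ (t • x) = 0 := by
          refine Function.notMem_support.1 fun hmem => hx ?_
          have h6 := support_fderiv_subset ℝ hmem
          rw [χ.tsupport_eq, mem_closedBall_zero_iff, norm_smul, Real.norm_of_nonneg ht.le] at h6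
          exact h6
        rw [h5, norm_zero, mul_zero]
        positivity
    have h7 : ‖regProfile q κ t x • t • fderiv ℝ χ (t • x)‖ ≤
        2 ^ (q / κ) * M * 3 * (1 + ‖x‖) ^ (-(q / κ + 1)) := by
      have h8 := regProfile_pos q κ t x
      have hX : 0 < 1 + ‖x‖ := by positivity
      rw [norm_smul, norm_smul, Real.norm_of_nonneg h8.le, Real.norm_of_nonneg ht.le]
      calc _ ≤ 2 ^ (q / κ) * (1 + ‖x‖) ^ (-(q / κ)) * (M * (3 / (1 + ‖x‖))) := by
            gcongr; exact regProfile_le hq0 hκ0 t x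
        _ = _ := by
            rw [show -(q / κ + 1) = -(q / κ) - 1 by ring, Real.rpow_sub_one hX.ne']
            ring
    rw [hB, add_mul]
    linarith
  have hst : n < (q / κ + 1) * p := by
    rw [conj_div_add_one_mul hpq hκ0 hκ]; exact lt_conj_mul_sub_one hpq hκ0 hκ
  have hts : ∀ x : EuclideanSpace ℝ (Fin n), Tendsto (fun t : ℝ => t • x) (𝓝[>] 0) (𝓝 0) :=
    fun x => by
      have : ContinuousAt (fun t : ℝ => t • x) 0 := by fun_prop
      simpa using this.tendsto.mono_left (nhdsWithin_le_nhds (s := Set.Ioi 0))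
  have hχt : ∀ x : EuclideanSpace ℝ (Fin n), Tendsto (fun t : ℝ => χ (t • x)) (𝓝[>] 0) (𝓝 1) :=
    fun x => by
      have h1 := (χ.continuous.tendsto 0).comp (hts x)
      rwa [χ.one_of_mem_closedBall (by simp [χ])] at h1
  refine ⟨φ, fun t ht => ⟨hφd t ht, ?_, ?_⟩, ?_, ?_⟩
  · exact (χ.hasCompactSupport.comp_smul ht.ne').mul_right
  · intro h0
    have h1 := congrFun h0 0
    simp only [hφ, smul_zero, Pi.zero_apply] at h1
    rw [χ.one_of_mem_closedBall (by simp [χ]), one_mul] at h1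
    exact (regProfile_pos q κ t (0 : EuclideanSpace ℝ (Fin n))).ne' h1
  · have e : ∫ x : EuclideanSpace ℝ (Fin n), (1 + ‖x‖ ^ q) ^ (-(n : ℝ)) =
        ∫ x : EuclideanSpace ℝ (Fin n), |regProfile q κ 0 x| ^ (κ * n) := by
      refine integral_congr_ae (.of_forall fun x => ?_)
      simp only
      rw [abs_of_pos (regProfile_pos _ _ _ _), regProfile_zero, ← Real.rpow_mul (by positivity)]
      congr 1
      field_simp
    rw [e]
    refine tendsto_integral_filter_of_dominated_convergence
      (fun x => (2 ^ (q / κ) * (1 + ‖x‖) ^ (-(q / κ))) ^ (κ * n)) ?_ ?_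
      (integrable_decay_rpow (by positivity) (by field_simp; nlinarith)) ?_
    · filter_upwards [hev] with t ht
      exact ((hφd t ht.1).continuous.measurable.abs.pow_const _).aestronglyMeasurable
    · refine .of_forall fun t => .of_forall fun x => ?_
      have := hφle t x
      rw [Real.norm_of_nonneg (by positivity)]
      gcongr
    · refine .of_forall fun x => Tendsto.rpow_const ?_ (Or.inr hκn.le)
      have h1 := (hχt x).mul ((tendsto_regProfile (κ := κ) hq0 x).mono_left
        (nhdsWithin_le_nhds (s := Set.Ioi 0)))
      rw [one_mul] at h1
      exact h1.abs
  · have e : (q / κ) ^ p *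
        ∫ x : EuclideanSpace ℝ (Fin n), ‖x‖ ^ q * (1 + ‖x‖ ^ q) ^ (-(n : ℝ)) =
        ∫ x : EuclideanSpace ℝ (Fin n), ‖fderiv ℝ (regProfile q κ 0) x‖ ^ p := by
      rw [← integral_norm_fderiv_one_add_rpow hn hpq hκ0 hκ, funext (regProfile_zero q κ)]
    rw [e]
    refine tendsto_integral_filter_of_dominated_convergence
      (fun x => (B * (1 + ‖x‖) ^ (-(q / κ + 1))) ^ p) ?_ ?_ (integrable_decay_rpow hB0 hst) ?_
    · exact .of_forall fun t =>
        ((measurable_fderiv ℝ (φ t)).norm.pow_const _).aestronglyMeasurable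
    · filter_upwards [hev] with t ht
      refine .of_forall fun x => ?_
      have := hgle t ht.1 ht.2 x
      rw [Real.norm_of_nonneg (by positivity)]
      gcongr
    · filter_upwards [Measure.ae_ne volume (0 : EuclideanSpace ℝ (Fin n))] with x hx
      refine Tendsto.rpow_const (Tendsto.norm ?_) (Or.inr hp0.le)
      have h1 : Tendsto (fun t => χ (t • x) • fderiv ℝ (regProfile q κ t) x +
          regProfile q κ t x • t • fderiv ℝ χ (t • x)) (𝓝[>] 0)
          (𝓝 ((1 : ℝ) • fderiv ℝ (regProfile q κ 0) x +
            regProfile q κ 0 x • (0 : ℝ) • fderiv ℝ χ 0)) := by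
        refine ((hχt x).smul ((tendsto_fderiv_regProfile hx).mono_left nhdsWithin_le_nhds)).add
          (((tendsto_regProfile hq0 x).mono_left nhdsWithin_le_nhds).smul
            ((tendsto_id.mono_left nhdsWithin_le_nhds).smul ?_))
        exact (((χ.contDiff (n := 1)).continuous_fderiv one_ne_zero).tendsto 0).comp (hts x)
      rw [one_smul, zero_smul, smul_zero, add_zero] at h1
      refine h1.congr' ?_
      filter_upwards [hev] with t ht
      exact (hfd t ht.1 x).symm

open Filter Topology in
theorem sobolevS_eq_profileQuotient {n : ℕ} {p q κ : ℝ} (hn : 2 ≤ n)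
    (hpq : p.HolderConjugate q) (hκ0 : 0 < κ) (hκ : (κ + 1) * p = κ * n)
    (hexp : (n : ℝ) * p / (n - p) = κ * n) : sobolevS n p = profileQuotient n p q κ := by
  have hn' : (2 : ℝ) ≤ n := by exact_mod_cast hn
  have hp0 : 0 < p := hpq.pos
  have hκn : 0 < κ * n := by positivity
  obtain ⟨φ, hφ, hden, hnum⟩ := exists_seq_contDiff_tendsto_profile hn hpq hκ0 hκ
  rw [sobolevS, hexp]
  refine le_antisymm ?_ ?_
  · have hD := integral_one_add_norm_rpow_pos hn hpq.symm.lt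
    have hlim := hnum.div (hden.rpow_const (p := p / (κ * n)) (Or.inl hD.ne'))
      (Real.rpow_pos_of_pos hD _).ne'
    refine ge_of_tendsto hlim ?_
    filter_upwards [self_mem_nhdsWithin] with t ht
    refine csInf_le ⟨0, ?_⟩ ⟨φ t, (hφ t ht).1, (hφ t ht).2.1, (hφ t ht).2.2, rfl⟩
    rintro _ ⟨u, -, -, -, rfl⟩
    exact div_nonneg (integral_nonneg fun x => by positivity)
      (Real.rpow_nonneg (integral_nonneg fun x => by positivity) _)
  · refine le_csInf ⟨_, φ 1, (hφ 1 one_pos).1, (hφ 1 one_pos).2.1, (hφ 1 one_pos).2.2, rfl⟩ ?_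
    rintro _ ⟨u, hu, hus, hu0, rfl⟩
    obtain ⟨x, hx⟩ := Function.ne_iff.1 hu0
    have hpos : 0 < ∫ x, |u x| ^ (κ * n) := by
      have hc : Continuous fun x => |u x| ^ (κ * n) :=
        hu.continuous.abs.rpow_const fun _ => Or.inr hκn.le
      refine integral_pos_of_integrable_nonneg_nonzero (x := x) hc
        (hc.integrable_of_hasCompactSupport (hus.comp_left (g := fun y => |y| ^ (κ * n)) ?_))
        (fun x => by positivity) (Real.rpow_pos_of_pos (abs_pos.2 hx) _).ne'
      simp [hκn.ne']
    rw [le_div_iff₀ (Real.rpow_pos_of_pos hpos _)]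
    exact profileQuotient_mul_le_of_contDiff hn hpq hκ0 hκ
      (hu.of_le (by exact_mod_cast le_top)) hus

/-- The Sobolev quotient is invariant under multiplication by constants and dilations. -/
theorem sobolevQuotient_smul_comp_inv_smul {n : ℕ} {p κ c ε : ℝ} (hκ0 : 0 < κ) (hp : 0 < p)
    (hn : 0 < n) (hκ : (κ + 1) * p = κ * n) (hc : 0 < c) (hε : 0 < ε)
    {w : EuclideanSpace ℝ (Fin n) → ℝ} (hw : ∀ x, 0 ≤ w x) :
    (∫ x, ‖fderiv ℝ (fun y => c * w (ε⁻¹ • y)) x‖ ^ p) /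
        (∫ x, (c * w (ε⁻¹ • x)) ^ (κ * n)) ^ (p / (κ * n)) =
      (∫ x, ‖fderiv ℝ w x‖ ^ p) / (∫ x, w x ^ (κ * n)) ^ (p / (κ * n)) := by
  have hn' : (0 : ℝ) < n := by exact_mod_cast hn
  have h1 (x) : ‖fderiv ℝ (fun y => c * w (ε⁻¹ • y)) x‖ ^ p =
      (c * ε⁻¹) ^ p * ‖fderiv ℝ w (ε⁻¹ • x)‖ ^ p := by
    have h2 : fderiv ℝ (fun y => c * w (ε⁻¹ • y)) = c • fderiv ℝ fun y => w (ε⁻¹ • y) :=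
      fderiv_const_smul_field c
    rw [h2, Pi.smul_apply, fderiv_comp_smul, norm_smul, norm_smul, Real.norm_of_nonneg hc.le,
      Real.norm_of_nonneg (by positivity), ← mul_assoc,
      Real.mul_rpow (by positivity) (by positivity)]
  have h3 (x) : (c * w (ε⁻¹ • x)) ^ (κ * n) = c ^ (κ * n) * w (ε⁻¹ • x) ^ (κ * n) :=
    Real.mul_rpow hc.le (hw _)
  have hD : 0 ≤ ∫ x, w x ^ (κ * n) := integral_nonneg fun x => Real.rpow_nonneg (hw x) _
  simp_rw [h1, h3, integral_const_mul]
  rw [Measure.integral_comp_inv_smul_of_nonneg volume (fun x => ‖fderiv ℝ w x‖ ^ p) hε.le,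
    Measure.integral_comp_inv_smul_of_nonneg volume (fun x => w x ^ (κ * n)) hε.le,
    finrank_euclideanSpace_fin, smul_eq_mul, smul_eq_mul, ← mul_assoc, ← mul_assoc,
    Real.mul_rpow (by positivity) hD]
  have h4 : (c ^ (κ * n) * ε ^ n) ^ (p / (κ * n)) = (c * ε⁻¹) ^ p * ε ^ n := by
    rw [Real.mul_rpow (by positivity) (by positivity), ← Real.rpow_mul hc.le,
      ← Real.rpow_natCast ε n, ← Real.rpow_mul hε.le, Real.mul_rpow hc.le (by positivity),
      Real.inv_rpow hε.le, ← Real.rpow_neg hε.le, mul_assoc (c ^ p), ← Real.rpow_add hε]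
    congr 2
    · field_simp
    · field_simp
      linear_combination hκ
  rw [h4]
  exact mul_div_mul_left _ _ (by positivity)

/-- For every `ε > 0` and every constant `C_{N,p} > 0`, the Talenti
function `u_ε(x) = C_{N,p} ε^{−(N−p)/p} (1 + (|x|/ε)^{p/(p−1)})^{−(N−p)/p}` attains the
best Sobolev constant: `∫|∇u_ε|^p / (∫ u_ε^{p*})^{p/p*} = S`. -/
theorem stmt_5 (N : ℕ) (hN : 2 ≤ N) (p : ℝ) (hp1 : 1 < p) (hpN : p < (N : ℝ))
    (Cnp : ℝ) (hC : 0 < Cnp) (ε : ℝ) (hε : 0 < ε)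
    (uε : EuclideanSpace ℝ (Fin N) → ℝ)
    (huε : ∀ x, uε x = Cnp * ε ^ (-((N : ℝ) - p) / p) *
      (1 + (‖x‖ / ε) ^ (p / (p - 1))) ^ (-((N : ℝ) - p) / p)) :
    (∫ x, ‖fderiv ℝ uε x‖ ^ p) /
      (∫ x, uε x ^ ((N : ℝ) * p / ((N : ℝ) - p))) ^ (p / ((N : ℝ) * p / ((N : ℝ) - p)))
      = sobolevS N p := by
  have hp0 : 0 < p := by linarith
  have hNp : 0 < (N : ℝ) - p := by linarith
  set q := p / (p - 1) with hq
  have hpq : p.HolderConjugate q := (Real.holderConjugate_iff_eq_conjExponent hp1).2 hq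
  set κ := p / ((N : ℝ) - p) with hκdef
  have hκ0 : 0 < κ := by positivity
  have hκ : (κ + 1) * p = κ * N := by rw [hκdef]; field_simp; ring
  have hexp : (N : ℝ) * p / (N - p) = κ * N := by rw [hκdef]; field_simp
  have hexp' : -((N : ℝ) - p) / p = -κ⁻¹ := by rw [hκdef, inv_div, neg_div]
  rw [sobolevS_eq_profileQuotient hN hpq hκ0 hκ hexp, hexp]
  have hu : uε = fun x => Cnp * ε ^ (-κ⁻¹) * (1 + ‖ε⁻¹ • x‖ ^ q) ^ (-κ⁻¹) := by
    funext x
    rw [huε, hexp', norm_smul, Real.norm_of_nonneg (by positivity), div_eq_inv_mul]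
  have hw (x : EuclideanSpace ℝ (Fin N)) :
      ((1 + ‖x‖ ^ q) ^ (-κ⁻¹)) ^ (κ * N) = (1 + ‖x‖ ^ q) ^ (-(N : ℝ)) := by
    rw [← Real.rpow_mul (by positivity)]
    congr 1
    field_simp
  rw [hu, sobolevQuotient_smul_comp_inv_smul (w := fun x => (1 + ‖x‖ ^ q) ^ (-κ⁻¹)) hκ0 hp0
    (by omega) hκ (by positivity) hε fun x => by positivity,
    integral_norm_fderiv_one_add_rpow hN hpq hκ0 hκ]
  simp_rw [hw]
  rfl
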